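/- Let {R_i}_{i∈I} be any collection of biclosed subsets of Φ⁺. Then the smallest closed subset of Φ⁺ containing ⋃_{i∈I} R_i is itself biclosed, and it is the least upper bound of the collection {R_i}_{i∈I} in the poset of biclosed subsets of Φ⁺ ordered by inclusion. -/

import Mathlib

open scoped NNReal

noncomputable section

/-- The ambient vector space `V = ℝ³`. -/
abbrev V : Type := Fin 3 → ℝ

/-- The symmetric bilinear form with `⟨αᵢ,αⱼ⟩ = 1` if `i = j` and `-1` otherwise. -/
def B (x y : V) : ℝ := 2 * (∑ i, x i * y i) - (∑ i, x i) * (∑ i, y i)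

/-- The associated quadratic form. -/
def Q (x : V) : ℝ := B x x

/-- The simple roots `α₁, α₂, α₃` (the standard basis vectors). -/
def α (i : Fin 3) : V := Pi.single i 1

/-- The set of simple roots. -/
def Δ : Set V := Set.range α

/-- `f` is the reflection `r_{αᵢ} : x ↦ x - 2⟨αᵢ,x⟩αᵢ` for some `i` (note `⟨αᵢ,αᵢ⟩ = 1`). -/
def IsSimpleReflection (f : V ≃ₗ[ℝ] V) : Prop :=
  ∃ i : Fin 3, ∀ x : V, f x = x - (2 * B (α i) x) • α i

/-- The group `W ≤ GL(V)` generated by the three simple reflections: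
the standard reflection representation of `U₃`. -/
def W : Subgroup (V ≃ₗ[ℝ] V) := Subgroup.closure {f | IsSimpleReflection f}

/-- The root system `Φ = {w·αᵢ : w ∈ W, i ∈ {1,2,3}}`. -/
def Φ : Set V := {x | ∃ w ∈ W, ∃ i : Fin 3, x = w (α i)}

/-- `Span_{≥0}(X)`: the set of nonnegative linear combinations of elements of `X`. -/
def nnspan (X : Set V) : Set V := (Submodule.span ℝ≥0 X : Set V)

/-- The positive roots `Φ⁺ = Φ ∩ Span_{≥0}(Δ)`. -/
def Φpos : Set V := Φ ∩ nnspan Δ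

/-- `R ⊆ Φ⁺` is closed if for all `a, b ∈ R`, `Span_{≥0}{a,b} ∩ Φ⁺ ⊆ R`. -/
def IsClosedSet (R : Set V) : Prop := ∀ a ∈ R, ∀ b ∈ R, nnspan {a, b} ∩ Φpos ⊆ R

/-- `R` is a biclosed subset of `Φ⁺`. -/
def IsBiclosed (R : Set V) : Prop := R ⊆ Φpos ∧ IsClosedSet R ∧ IsClosedSet (Φpos \ R)

/-! ### Linear algebra of the form and of the cones -/

lemma B_eq (x y : V) : B x y = 2 * (x 0 * y 0 + x 1 * y 1 + x 2 * y 2) -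
    (x 0 + x 1 + x 2) * (y 0 + y 1 + y 2) := by
  simp [B, Fin.sum_univ_three]

lemma B_comm (x y : V) : B x y = B y x := by
  simp only [B_eq]; ring

/-- The form as a linear functional in its first argument. -/
def Bl (y : V) : V →ₗ[ℝ] ℝ where
  toFun x := B x y
  map_add' a b := by simp only [B_eq, Pi.add_apply]; ring
  map_smul' r a := by simp only [B_eq, Pi.smul_apply, smul_eq_mul, RingHom.id_apply]; ring

lemma Bl_apply (x y : V) : Bl y x = B x y := rfl

lemma B_add_left (a b y : V) : B (a + b) y = B a y + B b y := map_add (Bl y) a b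
lemma B_sub_left (a b y : V) : B (a - b) y = B a y - B b y := map_sub (Bl y) a b
lemma B_neg_left (a y : V) : B (-a) y = -B a y := map_neg (Bl y) a
lemma B_smul_left (r : ℝ) (a y : V) : B (r • a) y = r * B a y := map_smul (Bl y) r a
lemma B_add_right (a b y : V) : B y (a + b) = B y a + B y b := by
  simp only [B_comm y, B_add_left]
lemma B_sub_right (a b y : V) : B y (a - b) = B y a - B y b := by
  simp only [B_comm y, B_sub_left]
lemma B_neg_right (a y : V) : B y (-a) = -B y a := by
  simp only [B_comm y, B_neg_left]
lemma B_smul_right (r : ℝ) (a y : V) : B y (r • a) = r * B y a := by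
  simp only [B_comm y, B_smul_left]

/-- The height of a vector: the sum of its coordinates. -/
def ht : V →ₗ[ℝ] ℝ where
  toFun v := v 0 + v 1 + v 2
  map_add' a b := by simp only [Pi.add_apply]; ring
  map_smul' r a := by simp only [Pi.smul_apply, smul_eq_mul, RingHom.id_apply]; ring

lemma ht_apply (v : V) : ht v = v 0 + v 1 + v 2 := rfl

lemma mem_nnspan_pair {a b v : V} :
    v ∈ nnspan {a, b} ↔ ∃ p q : ℝ, 0 ≤ p ∧ 0 ≤ q ∧ v = p • a + q • b := by
  unfold nnspan
  rw [SetLike.mem_coe, Submodule.mem_span_pair]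
  constructor
  · rintro ⟨p, q, h⟩
    exact ⟨p, q, p.2, q.2, h.symm⟩
  · rintro ⟨p, q, hp, hq, h⟩
    exact ⟨⟨p, hp⟩, ⟨q, hq⟩, h.symm⟩

lemma mem_nnspan_Δ {v : V} : v ∈ nnspan Δ ↔ ∀ i, 0 ≤ v i := by
  constructor
  · intro h
    refine Submodule.span_induction (p := fun v _ => ∀ i, 0 ≤ v i) ?_ ?_ ?_ ?_ h
    · rintro _ ⟨j, rfl⟩ i
      by_cases hij : i = j <;> simp [α, hij]
    · simp
    · intro x y _ _ hx hy i
      exact add_nonneg (hx i) (hy i)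
    · intro r x _ hx i
      exact mul_nonneg r.2 (hx i)
  · intro h
    have hv : v = ∑ i, (⟨v i, h i⟩ : ℝ≥0) • α i := by
      ext j
      simp [α, Finset.sum_apply, Pi.single_apply]
    rw [hv]
    exact Submodule.sum_mem _ fun i _ => Submodule.smul_mem _ _ (Submodule.subset_span ⟨i, rfl⟩)

/-! ### Arithmetic description of the positive roots -/

/-- Vectors with integer coordinates. -/
def IsInt (f : V) : Prop := ∀ i, ∃ k : ℤ, f i = k

/-- Integer vectors of norm one; these turn out to be the real roots. -/
def IsRt (f : V) : Prop := IsInt f ∧ B f f = 1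

/-- Nonnegative integer vectors of norm one; these turn out to be the positive roots. -/
def IsPos (f : V) : Prop := IsRt f ∧ ∀ i, 0 ≤ f i

lemma IsInt.add {f g : V} (hf : IsInt f) (hg : IsInt g) : IsInt (f + g) := fun i => by
  obtain ⟨a, ha⟩ := hf i
  obtain ⟨b, hb⟩ := hg i
  exact ⟨a + b, by simp [ha, hb]⟩

lemma IsInt.smul {f : V} (hf : IsInt f) (k : ℤ) : IsInt ((k : ℝ) • f) := fun i => by
  obtain ⟨a, ha⟩ := hf i
  exact ⟨k * a, by simp [ha]⟩

lemma IsInt.neg {f : V} (hf : IsInt f) : IsInt (-f) := fun i => by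
  obtain ⟨a, ha⟩ := hf i
  exact ⟨-a, by simp [ha]⟩

lemma IsInt.sub {f g : V} (hf : IsInt f) (hg : IsInt g) : IsInt (f - g) := by
  rw [sub_eq_add_neg]
  exact hf.add hg.neg

lemma IsInt.exists_B {f g : V} (hf : IsInt f) (hg : IsInt g) : ∃ k : ℤ, B f g = k := by
  obtain ⟨a, ha⟩ := hf 0
  obtain ⟨b, hb⟩ := hf 1
  obtain ⟨c, hc⟩ := hf 2
  obtain ⟨a', ha'⟩ := hg 0
  obtain ⟨b', hb'⟩ := hg 1
  obtain ⟨c', hc'⟩ := hg 2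
  exact ⟨2 * (a * a' + b * b' + c * c') - (a + b + c) * (a' + b' + c'), by
    rw [B_eq, ha, hb, hc, ha', hb', hc']; push_cast; ring⟩

lemma IsInt.exists_B_eq {f g : V} (hf : IsInt f) (hg : IsInt g) :
    ∃ k m n : ℤ, B f g = 2 * k - m * n ∧ ht f = m ∧ ht g = n := by
  obtain ⟨a, ha⟩ := hf 0
  obtain ⟨b, hb⟩ := hf 1
  obtain ⟨c, hc⟩ := hf 2
  obtain ⟨a', ha'⟩ := hg 0
  obtain ⟨b', hb'⟩ := hg 1
  obtain ⟨c', hc'⟩ := hg 2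
  exact ⟨a * a' + b * b' + c * c', a + b + c, a' + b' + c', by
    rw [B_eq, ha, hb, hc, ha', hb', hc']; push_cast; ring,
    by rw [ht_apply, ha, hb, hc]; push_cast; ring,
    by rw [ht_apply, ha', hb', hc']; push_cast; ring⟩

lemma IsRt.exists_ht {f : V} (hf : IsRt f) : ∃ k : ℤ, ht f = 2 * k + 1 := by
  obtain ⟨k, m, n, h, hm, hn⟩ := hf.1.exists_B_eq hf.1
  obtain rfl : m = n := by exact_mod_cast hm.symm.trans hn
  rw [hf.2] at h
  have h' : (1 : ℤ) = 2 * k - m * m := by exact_mod_cast h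
  obtain ⟨l, hl⟩ | ⟨l, hl⟩ := m.even_or_odd
  · exfalso
    subst hl
    have : (1 : ℤ) = 2 * (k - 2 * l * l) := by linarith
    omega
  · exact ⟨l, by rw [hm, hl]; push_cast; ring⟩

lemma IsRt.exists_B {f g : V} (hf : IsRt f) (hg : IsRt g) : ∃ k : ℤ, B f g = 2 * k + 1 := by
  obtain ⟨k, m, n, h, hm, hn⟩ := hf.1.exists_B_eq hg.1
  obtain ⟨i, hi⟩ := hf.exists_ht
  obtain ⟨j, hj⟩ := hg.exists_ht
  refine ⟨k - 2 * i * j - i - j - 1, ?_⟩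
  rw [h, ← hm, ← hn, hi, hj]
  push_cast
  ring

lemma IsRt.B_or {f g : V} (hf : IsRt f) (hg : IsRt g) : 1 ≤ B f g ∨ B f g ≤ -1 := by
  obtain ⟨k, hk⟩ := hf.exists_B hg
  rw [hk]
  rcases le_or_gt 0 k with h | h
  · left
    have : (0 : ℝ) ≤ k := by exact_mod_cast h
    linarith
  · right
    have : (k : ℝ) ≤ -1 := by exact_mod_cast Int.le_sub_one_of_lt h
    linarith

lemma IsRt.one_le_B {f g : V} (hf : IsRt f) (hg : IsRt g) (h : 0 ≤ B f g) : 1 ≤ B f g := by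
  rcases hf.B_or hg with h' | h' <;> linarith

lemma IsRt.B_le {f g : V} (hf : IsRt f) (hg : IsRt g) (h : B f g ≤ 0) : B f g ≤ -1 := by
  rcases hf.B_or hg with h' | h' <;> linarith

lemma IsRt.neg {f : V} (hf : IsRt f) : IsRt (-f) :=
  ⟨hf.1.neg, by rw [B_neg_left, B_neg_right, neg_neg, hf.2]⟩

lemma IsRt.reflect {f g : V} (hf : IsRt f) (hg : IsRt g) : IsRt (g - (2 * B f g) • f) := by
  obtain ⟨k, hk⟩ := hf.1.exists_B hg.1
  constructor
  · have := hg.1.sub (hf.1.smul (2 * k))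
    rw [hk]
    exact_mod_cast this
  · simp only [B_sub_left, B_sub_right, B_smul_left, B_smul_right, hf.2, hg.2, B_comm g f]
    ring

lemma IsRt.mul_nonneg {x y z : ℤ}
    (h : 2 * (x * x + y * y + z * z) - (x + y + z) * (x + y + z) = 1) :
    0 ≤ x * y := by
  have h1 : 4 * (x * y) = (z - x - y) ^ 2 - 1 := by linarith
  nlinarith [sq_nonneg (z - x - y)]

lemma IsRt.sign {f : V} (hf : IsRt f) : (∀ i, 0 ≤ f i) ∨ ∀ i, f i ≤ 0 := by
  obtain ⟨⟨x, hx⟩, ⟨y, hy⟩, ⟨z, hz⟩⟩ := hf.1 0, hf.1 1, hf.1 2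
  have h := hf.2
  rw [B_eq, hx, hy, hz] at h
  have h : 2 * (x * x + y * y + z * z) - (x + y + z) * (x + y + z) = 1 := by exact_mod_cast h
  have h1 := IsRt.mul_nonneg h
  have h2 := IsRt.mul_nonneg (x := y) (y := z) (z := x) (by linarith)
  have h3 := IsRt.mul_nonneg (x := z) (y := x) (z := y) (by linarith)
  have key (p : ℝ → Prop) (h0 : p x) (h1 : p y) (h2 : p z) : ∀ i, p (f i) := by
    intro i
    fin_cases i
    exacts [hx ▸ h0, hy ▸ h1, hz ▸ h2]
  simp only [mul_nonneg_iff] at h1 h2 h3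
  have : (0 ≤ x ∧ 0 ≤ y ∧ 0 ≤ z) ∨ (x ≤ 0 ∧ y ≤ 0 ∧ z ≤ 0) := by omega
  rcases this with ⟨hx, hy, hz⟩ | ⟨hx, hy, hz⟩
  · exact Or.inl (key (0 ≤ ·) (by exact_mod_cast hx) (by exact_mod_cast hy) (by exact_mod_cast hz))
  · exact Or.inr (key (· ≤ 0) (by exact_mod_cast hx) (by exact_mod_cast hy) (by exact_mod_cast hz))

lemma IsRt.pos_or {f : V} (hf : IsRt f) : IsPos f ∨ IsPos (-f) := by
  rcases hf.sign with h | h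
  · exact Or.inl ⟨hf, h⟩
  · exact Or.inr ⟨hf.neg, fun i => by simpa using h i⟩

lemma IsPos.ht_pos {f : V} (hf : IsPos f) : 0 < ht f := by
  by_contra h
  have h0 := hf.2 0
  have h1 := hf.2 1
  have h2 := hf.2 2
  rw [ht_apply] at h
  have e0 : f 0 = 0 := by linarith
  have e1 : f 1 = 0 := by linarith
  have e2 : f 2 = 0 := by linarith
  have := hf.1.2
  rw [B_eq, e0, e1, e2] at this
  norm_num at this

lemma isRt_α (i : Fin 3) : IsRt (α i) := by
  constructor
  · intro j
    by_cases h : j = i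
    · exact ⟨1, by simp [α, h]⟩
    · exact ⟨0, by simp [α, h]⟩
  · fin_cases i <;> simp [B_eq, α] <;> norm_num

lemma reflect_reflect {f : V} (hf : B f f = 1) (g : V) :
    g - (2 * B f g) • f - (2 * B f (g - (2 * B f g) • f)) • f = g := by
  rw [B_sub_right, B_smul_right, hf]
  module

/-- The simple reflections as linear equivalences. -/
def simpleReflection (i : Fin 3) : V ≃ₗ[ℝ] V :=
  LinearEquiv.ofInvolutive
    { toFun := fun x => x - (2 * B (α i) x) • α i
      map_add' := fun x y => by rw [B_add_right]; module
      map_smul' := fun r x => by rw [B_smul_right, RingHom.id_apply]; module }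
    (fun x => reflect_reflect (isRt_α i).2 x)

lemma simpleReflection_apply (i : Fin 3) (x : V) :
    simpleReflection i x = x - (2 * B (α i) x) • α i := rfl

lemma isRt_iff_of_mem_W {w : V ≃ₗ[ℝ] V} (hw : w ∈ W) : ∀ v, IsRt v ↔ IsRt (w v) := by
  refine Subgroup.closure_induction (p := fun w _ => ∀ v, IsRt v ↔ IsRt (w v)) ?_ ?_ ?_ ?_ hw
  · rintro f ⟨i, hi⟩ v
    rw [hi]
    refine ⟨(isRt_α i).reflect, fun h => ?_⟩
    have := (isRt_α i).reflect h
    rwa [reflect_reflect (isRt_α i).2] at this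
  · intro v
    rfl
  · intro x y _ _ hx hy v
    rw [hy v, hx]
    rfl
  · intro x _ hx v
    have := hx (x⁻¹ v)
    rw [this]
    change _ ↔ _
    rw [show x (x⁻¹ v) = v from x.apply_symm_apply v]

lemma IsPos.mem_Φ_of_ht_le (n : ℕ) : ∀ f : V, IsPos f → ht f ≤ n → f ∈ Φ := by
  induction n with
  | zero =>
    intro f hf h
    have := hf.ht_pos
    norm_num at h
    linarith
  | succ n ih =>
    intro f hf h
    have hex : ∃ i, 1 ≤ B (α i) f := by
      by_contra! hcon
      have key : ∀ i, B (α i) f ≤ -1 := fun i =>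
        ((isRt_α i).B_or hf.1).resolve_left (not_le.2 (hcon i))
      have h1 : B f f = f 0 * B (α 0) f + f 1 * B (α 1) f + f 2 * B (α 2) f := by
        simp [B_eq, α]; ring
      have := hf.1.2
      nlinarith [key 0, key 1, key 2, hf.2 0, hf.2 1, hf.2 2]
    obtain ⟨i, hi⟩ := hex
    have hht : ht (α i) = 1 := by fin_cases i <;> simp [ht_apply, α]
    rcases ((isRt_α i).reflect hf.1).pos_or with hp | hp
    · have hlt : ht (f - (2 * B (α i) f) • α i) ≤ n := by
        rw [map_sub, map_smul, hht, smul_eq_mul]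
        push_cast at h
        linarith
      obtain ⟨w, hw, j, hj⟩ := ih _ hp hlt
      refine ⟨simpleReflection i * w, W.mul_mem (Subgroup.subset_closure
        ⟨i, simpleReflection_apply i⟩) hw, j, ?_⟩
      change f = simpleReflection i (w (α j))
      rw [← hj, simpleReflection_apply, reflect_reflect (isRt_α i).2]
    · refine ⟨1, W.one_mem, i, ?_⟩
      have hz : ∀ j, j ≠ i → f j = 0 := fun j hj => by
        have h1 := hp.2 j
        have h2 := hf.2 j
        simp [α, hj] at h1
        linarith
      have hf1 := hf.1.2
      have hf0 := hf.2 i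
      change f = α i
      have h1 : f = f i • α i := by
        ext j
        by_cases hj : j = i
        · simp [α, hj]
        · simp [α, hj, hz j hj]
      rw [h1, B_smul_left, B_smul_right, (isRt_α i).2] at hf1
      have : f i = 1 := by nlinarith
      rw [h1, this, one_smul]

lemma mem_Φpos {f : V} : f ∈ Φpos ↔ IsPos f := by
  constructor
  · rintro ⟨⟨w, hw, i, rfl⟩, h⟩
    exact ⟨(isRt_iff_of_mem_W hw _).1 (isRt_α i), mem_nnspan_Δ.1 h⟩
  · intro hf
    obtain ⟨n, hn⟩ := exists_nat_ge (ht f)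
    exact ⟨hf.mem_Φ_of_ht_le n f hn, mem_nnspan_Δ.2 hf.2⟩

/-! ### Pairs of positive roots and rank-two decompositions -/

lemma gram_ineq {f g : V} (hf : B f f = 1) (hg : B g g = 1) :
    3 * (B f g ^ 2 - 1) ≤ ht f ^ 2 + ht g ^ 2 - 2 * B f g * ht f * ht g := by
  have key : ht f ^ 2 * B g g + ht g ^ 2 * B f f - 2 * B f g * ht f * ht g
      + 3 * B f f * B g g - 3 * B f g ^ 2 =
      4 * (f 0 * g 1 - f 1 * g 0 + (f 1 * g 2 - f 2 * g 1) + (f 2 * g 0 - f 0 * g 2)) ^ 2 := by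
    simp only [B_eq, ht_apply]; ring
  rw [hf, hg] at key
  nlinarith [sq_nonneg (f 0 * g 1 - f 1 * g 0 + (f 1 * g 2 - f 2 * g 1) +
    (f 2 * g 0 - f 0 * g 2))]

lemma IsRt.ht_add_two_le {f g : V} (hf : IsRt f) (hg : IsRt g) (h : ht f < ht g) :
    ht f + 2 ≤ ht g := by
  obtain ⟨k, hk⟩ := hf.exists_ht
  obtain ⟨l, hl⟩ := hg.exists_ht
  rw [hk, hl] at h ⊢
  have h' : 2 * k + 1 < 2 * l + 1 := by exact_mod_cast h
  have : 2 * k + 1 + 2 ≤ 2 * l + 1 := by omega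
  exact_mod_cast this

lemma IsPos.one_le_ht {f : V} (hf : IsPos f) : 1 ≤ ht f := by
  obtain ⟨k, hk⟩ := hf.1.exists_ht
  have h := hf.ht_pos
  rw [hk] at h ⊢
  have h' : 0 < 2 * k + 1 := by exact_mod_cast h
  exact_mod_cast h'

lemma IsPos.mul_ht_lt {f g : V} (hf : IsPos f) (hg : IsPos g) (h : ht f < ht g) :
    B f g * ht f < ht g := by
  by_contra! hc
  have hx := hf.one_le_ht
  have h1 := gram_ineq hf.1.2 hg.1.2
  have hB : 1 < B f g := by
    by_contra! h2
    nlinarith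
  have h2 : (B f g * ht f - ht g) ^ 2 ≤ ((B f g - 1) * ht f) ^ 2 := by
    apply pow_le_pow_left₀ <;> nlinarith
  nlinarith [mul_pos (sub_pos.2 hB) (mul_pos hf.ht_pos hf.ht_pos)]

lemma IsPos.sub_lt {f g : V} (hf : IsPos f) (hg : IsPos g) (hB : 1 ≤ B f g) (h : ht f < ht g) :
    2 * B f g * ht f - ht g < ht f := by
  by_contra! hc
  have hx := hf.one_le_ht
  have h1 := gram_ineq hf.1.2 hg.1.2
  have h2 := hf.mul_ht_lt hg h
  have h3 : (ht g - B f g * ht f) ^ 2 ≤ ((B f g - 1) * ht f) ^ 2 := by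
    apply pow_le_pow_left₀ <;> nlinarith
  rcases hB.eq_or_lt with hB | hB
  · rw [← hB] at hc
    linarith
  · nlinarith [mul_pos (sub_pos.2 hB) (mul_pos hf.ht_pos hf.ht_pos)]

lemma IsPos.eq_of_ht_eq {f g : V} (hf : IsPos f) (hg : IsPos g) (hB : 1 ≤ B f g)
    (h : ht f = ht g) : f = g := by
  have h1 := gram_ineq hf.1.2 hg.1.2
  rw [h] at h1
  have hB1 : B f g = 1 := by
    nlinarith [mul_nonneg (sub_nonneg.2 hB) (mul_pos hg.ht_pos hg.ht_pos).le]
  have hd : B (f - g) (f - g) = 0 := by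
    rw [B_sub_left, B_sub_right, B_sub_right, B_comm g f, hf.1.2, hg.1.2, hB1]
    ring
  have hs : (f - g) 0 + (f - g) 1 + (f - g) 2 = 0 := by
    rw [← ht_apply, map_sub, h, sub_self]
  rw [B_eq, hs] at hd
  rw [← sub_eq_zero]
  ext i
  fin_cases i <;> simp only [Fin.zero_eta, Fin.mk_one, Fin.reduceFinMk, Pi.zero_apply] <;>
    nlinarith [mul_self_nonneg ((f - g) 0), mul_self_nonneg ((f - g) 1),
      mul_self_nonneg ((f - g) 2)]

/-- A positive root `g` lies in the interior of the cone spanned by any lower root `f` with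
`⟨f, g⟩ ≥ 1` and a second root lower than `g`. -/
lemma IsPos.exists_ancestor_of_ht_le (n : ℕ) : ∀ f g : V, IsPos f → IsPos g → 1 ≤ B f g →
    ht f < ht g → ht f ≤ n → ∃ o, IsPos o ∧ ht o < ht g ∧
      ∃ p q : ℝ, 1 ≤ p ∧ 0 < q ∧ g = p • f + q • o := by
  induction n with
  | zero =>
    intro f g hf _ _ _ h
    have := hf.ht_pos
    norm_num at h
    linarith
  | succ n ih =>
    intro f g hf hg hB hlt hn
    rcases (hf.1.reflect hg.1).pos_or with ho | ho
    · refine ⟨_, ho, ?_, 2 * B f g, 1, by linarith, one_pos, by module⟩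
      rw [map_sub, map_smul, smul_eq_mul]
      nlinarith [hf.ht_pos]
    · rw [neg_sub] at ho
      have hlt' : ht ((2 * B f g) • f - g) < ht f := by
        rw [map_sub, map_smul, smul_eq_mul]
        exact hf.sub_lt hg hB hlt
      have hB' : 1 ≤ B ((2 * B f g) • f - g) f := by
        rw [B_sub_left, B_smul_left, hf.1.2, B_comm g f]
        linarith
      have hn' := ho.1.ht_add_two_le hf.1 hlt'
      push_cast at hn
      obtain ⟨o, hop, hof, p, q, hp, hq, he⟩ := ih _ f ho hf hB' hlt' (by linarith)
      have hp0 : (0 : ℝ) < p := by linarith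
      have hpi : p⁻¹ ≤ 1 := inv_le_one_of_one_le₀ hp
      refine ⟨o, hop, hof.trans hlt, 2 * B f g - p⁻¹, p⁻¹ * q, by linarith, by positivity, ?_⟩
      have h1 : p⁻¹ • f = (2 * B f g) • f - g + (p⁻¹ * q) • o := by
        conv_lhs => rw [he]
        rw [smul_add, smul_smul, smul_smul, inv_mul_cancel₀ hp0.ne', one_smul]
      rw [sub_smul, h1]
      module

lemma IsPos.exists_ancestor {f g : V} (hf : IsPos f) (hg : IsPos g) (hB : 1 ≤ B f g)
    (h : ht f < ht g) : ∃ o, IsPos o ∧ ht o < ht g ∧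
      ∃ p q : ℝ, 1 ≤ p ∧ 0 < q ∧ g = p • f + q • o := by
  obtain ⟨n, hn⟩ := exists_nat_ge (ht f)
  exact IsPos.exists_ancestor_of_ht_le n f g hf hg hB h hn

/-- `v` is a nonnegative combination of `a` and `b`. -/
def InCone (v a b : V) : Prop := ∃ p q : ℝ, 0 ≤ p ∧ 0 ≤ q ∧ v = p • a + q • b

lemma InCone.symm {v a b : V} (h : InCone v a b) : InCone v b a := by
  obtain ⟨p, q, hp, hq, h⟩ := h
  exact ⟨q, p, hq, hp, by rw [h, add_comm]⟩

lemma InCone.trans {v w a b : V} (h : InCone v w a) (h' : InCone w a b) : InCone v a b := by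
  obtain ⟨p, q, hp, hq, rfl⟩ := h
  obtain ⟨p', q', hp', hq', rfl⟩ := h'
  exact ⟨p * p' + q, p * q', by positivity, by positivity, by module⟩

lemma IsPos.pos_of_eq_add {v a b : V} {p q : ℝ} (hv : IsPos v) (hb : IsPos b) (hp : 0 ≤ p)
    (hq : 0 ≤ q) (h : v = p • a + q • b) (hne : v ≠ b) : 0 < p := by
  rcases hp.eq_or_lt with rfl | hp
  · rw [zero_smul, zero_add] at h
    have := hv.1.2
    rw [h, B_smul_left, B_smul_right, hb.1.2] at this
    have hq1 : q = 1 := by nlinarith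
    rw [hq1, one_smul] at h
    exact absurd h hne
  · exact hp

lemma IsPos.lower_of_inCone_aux {v a b : V} {p q : ℝ} (hv : IsPos v) (ha : IsPos a) (hb : IsPos b)
    (hp : 0 < p) (hq : 0 < q) (h : v = p • a + q • b) (hne : v ≠ a) (hne' : v ≠ b)
    (hB : 1 ≤ B v b) : ht b < ht v ∨ (1 ≤ B v a ∧ ht a < ht v) := by
  by_contra! hcon
  obtain ⟨hb1, ha1⟩ := hcon
  have hb2 := hv.mul_ht_lt hb (hb1.lt_of_ne fun e => hne' (hv.eq_of_ht_eq hb hB e))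
  have hht : ht v = p * ht a + q * ht b := by
    conv_lhs => rw [h]
    simp
  have h1 : 1 = p * B v a + q * B v b := by
    rw [← B_smul_right, ← B_smul_right, ← B_add_right, ← h, hv.1.2]
  have hx := hv.ht_pos
  have hBa : 1 ≤ B v a := by
    apply hv.1.one_le_B ha.1
    by_contra! hneg
    have : p * B v a < 0 := mul_neg_of_pos_of_neg hp hneg
    have h2 : q * (B v b * ht v) < q * ht b := mul_lt_mul_of_pos_left hb2 hq
    have h3 := mul_pos hp ha.ht_pos
    have h4 : (q * B v b - 1) * ht v > 0 := mul_pos (by linarith) hx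
    linarith
  have ha2 := hv.mul_ht_lt ha ((ha1 hBa).lt_of_ne fun e => hne (hv.eq_of_ht_eq ha hBa e))
  have h2 : q * (B v b * ht v) < q * ht b := mul_lt_mul_of_pos_left hb2 hq
  have h3 : p * (B v a * ht v) < p * ht a := mul_lt_mul_of_pos_left ha2 hp
  have h4 : (p * B v a + q * B v b) * ht v = ht v := by rw [← h1, one_mul]
  linarith

/-- If a positive root `v` lies in the cone of two other positive roots, then one of these is
lower than `v` and pairs positively with it. -/
lemma IsPos.lower_of_inCone {v a b : V} (hv : IsPos v) (ha : IsPos a) (hb : IsPos b)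
    (h : InCone v a b) (hne : v ≠ a) (hne' : v ≠ b) :
    (1 ≤ B v b ∧ ht b < ht v) ∨ (1 ≤ B v a ∧ ht a < ht v) := by
  obtain ⟨p, q, hp, hq, h⟩ := h
  have hp := hv.pos_of_eq_add hb hp hq h hne'
  have h' : v = q • b + p • a := by rw [h, add_comm]
  have hq := hv.pos_of_eq_add ha hq hp.le h' hne
  have h1 : 1 = p * B v a + q * B v b := by
    rw [← B_smul_right, ← B_smul_right, ← B_add_right, ← h, hv.1.2]
  rcases hv.1.B_or hb.1 with hB | hB
  · rcases hv.lower_of_inCone_aux ha hb hp hq h hne hne' hB with h2 | h2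
    exacts [Or.inl ⟨hB, h2⟩, Or.inr h2]
  · have hB : 1 ≤ B v a := by
      apply hv.1.one_le_B ha.1
      by_contra! hneg
      nlinarith
    rcases hv.lower_of_inCone_aux hb ha hq hp h' hne' hne hB with h2 | h2
    exacts [Or.inr ⟨hB, h2⟩, Or.inl h2]

lemma inCone_or_inCone {v a b o : V} {p q p' q' : ℝ} (hp : 0 < p) (hq : 0 < q) (hp' : 0 < p')
    (hq' : 0 < q') (h : v = p • a + q • b) (h' : v = p' • b + q' • o) :
    InCone o v a ∨ InCone a v o := by
  have hb : b = p'⁻¹ • v - (p'⁻¹ * q') • o := by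
    conv_rhs => rw [h']
    rw [smul_add, smul_smul, inv_mul_cancel₀ hp'.ne', smul_smul]
    module
  have key : p • a = (1 - q / p') • v + (q * q' / p') • o := by
    have : p • a = v - q • b := by rw [h]; module
    rw [this, hb, div_eq_mul_inv, div_eq_mul_inv]
    module
  rcases le_total q p' with hle | hle
  · right
    refine ⟨p⁻¹ * (1 - q / p'), p⁻¹ * (q * q' / p'), ?_, by positivity, ?_⟩
    · have : q / p' ≤ 1 := (div_le_one hp').2 hle
      exact mul_nonneg (inv_nonneg.2 hp.le) (by linarith)
    · rw [← smul_smul, ← smul_smul, ← smul_add, ← key, smul_smul, inv_mul_cancel₀ hp.ne', one_smul]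
  · left
    have hc : 0 < q * q' / p' := by positivity
    refine ⟨(q * q' / p')⁻¹ * (q / p' - 1), (q * q' / p')⁻¹ * p, ?_, by positivity, ?_⟩
    · have : 1 ≤ q / p' := (one_le_div hp').2 hle
      exact mul_nonneg (inv_nonneg.2 hc.le) (by linarith)
    · rw [← smul_smul, ← smul_smul, key, ← smul_add]
      have : (q / p' - 1) • v + ((1 - q / p') • v + (q * q' / p') • o) = (q * q' / p') • o := by
        module
      rw [this, smul_smul, inv_mul_cancel₀ hc.ne', one_smul]

/-- The exchange lemma for positive roots in a common cone, with `b` the lower generator. -/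
lemma IsPos.exists_exchange {v a b : V} (hv : IsPos v) (ha : IsPos a) (hb : IsPos b)
    (h : InCone v a b) (hne : v ≠ a) (hne' : v ≠ b) (hB : 1 ≤ B v b) (hlt : ht b < ht v) :
    ∃ o, IsPos o ∧ ht o < ht v ∧ InCone v b o ∧ (InCone o v a ∨ InCone a v o) := by
  obtain ⟨p, q, hp, hq, h⟩ := h
  have hp := hv.pos_of_eq_add hb hp hq h hne'
  have hq := hv.pos_of_eq_add ha hq hp.le (by rw [h, add_comm]) hne
  rw [B_comm] at hB
  obtain ⟨o, ho, hov, p', q', hp', hq', h'⟩ := hb.exists_ancestor hv hB hlt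
  have hp' : 0 < p' := by linarith
  exact ⟨o, ho, hov, ⟨p', q', hp'.le, hq'.le, h'⟩, inCone_or_inCone hp hq hp' hq' h h'⟩

/-! ### A linear order on the positive roots -/

/-- An injective numbering of the positive roots that refines the height. -/
def key (f : V) : ℕ :=
  (⌊ht f⌋₊ + 1) ^ 3 + ⌊f 0⌋₊ * (⌊ht f⌋₊ + 1) + ⌊f 1⌋₊

lemma IsPos.exists_nat {f : V} (hf : IsPos f) :
    ∃ x y z : ℕ, f 0 = x ∧ f 1 = y ∧ f 2 = z ∧ ht f = (x + y + z : ℕ) ∧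
      key f = (x + y + z + 1) ^ 3 + x * (x + y + z + 1) + y := by
  have h (i) : ∃ k : ℕ, f i = k := by
    obtain ⟨k, hk⟩ := hf.1.1 i
    have h0 := hf.2 i
    rw [hk] at h0
    lift k to ℕ using by exact_mod_cast h0
    exact ⟨k, by simpa using hk⟩
  obtain ⟨⟨x, hx⟩, ⟨y, hy⟩, ⟨z, hz⟩⟩ := h 0, h 1, h 2
  have hht : ht f = (x + y + z : ℕ) := by rw [ht_apply, hx, hy, hz]; push_cast; ring
  exact ⟨x, y, z, hx, hy, hz, hht, by rw [key, hht, hx, hy]; simp only [Nat.floor_natCast]⟩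

lemma key_lt_key {f g : V} (hf : IsPos f) (hg : IsPos g) (h : ht f < ht g) : key f < key g := by
  obtain ⟨x, y, z, -, -, -, hhf, hkf⟩ := hf.exists_nat
  obtain ⟨x', y', z', -, -, -, hhg, hkg⟩ := hg.exists_nat
  rw [hhf, hhg] at h
  have h : x + y + z < x' + y' + z' := by exact_mod_cast h
  rw [hkf, hkg]
  have h1 : (x + y + z + 2) ^ 3 ≤ (x' + y' + z' + 1) ^ 3 := Nat.pow_le_pow_left (by omega) 3
  have h2 : x ≤ x + y + z := by omega
  have h3 : y ≤ x + y + z := by omega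
  generalize x + y + z = s at *
  have h4 : x * (s + 1) ≤ s * (s + 1) := Nat.mul_le_mul_right _ h2
  nlinarith [Nat.zero_le (x' * (x' + y' + z' + 1)), Nat.zero_le (s ^ 2)]

lemma ht_le_ht {f g : V} (hf : IsPos f) (hg : IsPos g) (h : key f ≤ key g) : ht f ≤ ht g := by
  by_contra! hc
  exact absurd (key_lt_key hg hf hc) (not_lt.2 h)

lemma key_injOn : Set.InjOn key {f | IsPos f} := by
  intro f hf g hg h
  have hht := le_antisymm (ht_le_ht hf hg h.le) (ht_le_ht hg hf h.ge)
  obtain ⟨x, y, z, hx, hy, hz, hhf, hkf⟩ := hf.exists_nat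
  obtain ⟨x', y', z', hx', hy', hz', hhg, hkg⟩ := hg.exists_nat
  rw [hhf, hhg] at hht
  have hht : x + y + z = x' + y' + z' := by exact_mod_cast hht
  rw [hkf, hkg, ← hht] at h
  have hlt : y < x + y + z + 1 := by omega
  have hlt' : y' < x + y + z + 1 := by omega
  have h1 : x * (x + y + z + 1) + y = x' * (x + y + z + 1) + y' := by omega
  have hx1 := congrArg (· / (x + y + z + 1)) h1
  have hy1 := congrArg (· % (x + y + z + 1)) h1
  have hpos : 0 < x + y + z + 1 := by omega
  simp only [mul_comm _ (x + y + z + 1), Nat.mul_add_div hpos, Nat.div_eq_of_lt hlt,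
    Nat.div_eq_of_lt hlt', Nat.mul_add_mod, Nat.mod_eq_of_lt hlt, Nat.mod_eq_of_lt hlt',
    add_zero] at hx1 hy1
  have hz1 : z = z' := by omega
  ext i
  fin_cases i
  · simp [hx, hx', hx1]
  · simp [hy, hy', hy1]
  · simp [hz, hz', hz1]

/-- The first positive roots in the order given by `key`. -/
def initial (n : ℕ) : Set V := {f | IsPos f ∧ key f < n}

lemma finite_initial (n : ℕ) : (initial n).Finite :=
  Set.Finite.of_finite_image
    ((Set.finite_Iio n).subset (by rintro _ ⟨f, hf, rfl⟩; exact hf.2))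
    (key_injOn.mono fun _ hf => hf.1)

/-! ### Separable sets and the closure construction -/

/-- `T` contains every element of `F` in the cone of two elements of `T`. -/
def RelClosed (F T : Set V) : Prop := ∀ a ∈ T, ∀ b ∈ T, ∀ v ∈ F, InCone v a b → v ∈ T

/-- The linear functional `θ` is positive on `T` and negative on the rest of `F`. -/
def Separates (θ : V →ₗ[ℝ] ℝ) (F T : Set V) : Prop :=
  (∀ v ∈ T, 0 < θ v) ∧ ∀ v ∈ F, v ∉ T → θ v < 0

/-- Every subset of `F` that is biclosed relative to `F` is cut out by a linear functional. -/
def Separable (F : Set V) : Prop :=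
  ∀ T ⊆ F, RelClosed F T → RelClosed F (F \ T) → ∃ θ, Separates θ F T

/-- The set generated from `X` by adding roots in cones of smaller generated roots. -/
inductive Gen (X : Set V) : V → Prop
  | base {x : V} : x ∈ X → Gen X x
  | step {x y v : V} : Gen X x → Gen X y → IsPos v → InCone v x y → key x < key v →
      key y < key v → Gen X v

lemma Gen.isPos {X : Set V} (hX : ∀ x ∈ X, IsPos x) {v : V} (h : Gen X v) : IsPos v := by
  cases h with
  | base h => exact hX _ h
  | step _ _ h _ _ _ => exact h

lemma InCone.map_pos {v a b : V} (h : InCone v a b) (hv : v ≠ 0) {θ : V →ₗ[ℝ] ℝ} (ha : 0 < θ a)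
    (hb : 0 < θ b) : 0 < θ v := by
  obtain ⟨p, q, hp, hq, rfl⟩ := h
  rw [map_add, map_smul, map_smul, smul_eq_mul, smul_eq_mul]
  rcases hp.eq_or_lt with rfl | hp
  · rcases hq.eq_or_lt with rfl | hq
    · simp at hv
    · nlinarith
  · nlinarith [mul_pos hp ha, mul_nonneg hq hb.le]

lemma InCone.map_neg {v a b : V} (h : InCone v a b) (hv : v ≠ 0) {θ : V →ₗ[ℝ] ℝ} (ha : θ a < 0)
    (hb : θ b < 0) : θ v < 0 := by
  have := h.map_pos (θ := -θ) hv (by simpa using ha) (by simpa using hb)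
  simpa using this

lemma IsPos.ne_zero {v : V} (hv : IsPos v) : v ≠ 0 := by
  rintro rfl
  simpa using hv.ht_pos

/-- `Gen X` is coclosed at `v`. -/
def GenCoclosedAt (X : Set V) (v : V) : Prop :=
  Gen X v → ∀ a b, IsPos a → IsPos b → InCone v a b → Gen X a ∨ Gen X b

lemma Gen.inCone_of_lower {X : Set V} (hX : ∀ x ∈ X, IsPos x) {v x y : V} (hx : Gen X x)
    (hy : Gen X y) (hv : IsPos v) (h : InCone v x y) (hne : v ≠ x) (hne' : v ≠ y)
    (hB : 1 ≤ B v y) (hlt : ht y < ht v) (hco : GenCoclosedAt X x)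
    (ih : ∀ o, IsPos o → key o < key v → InCone o x y → Gen X o) : Gen X v := by
  have hyp := hy.isPos hX
  obtain ⟨o, ho, hov, hc, hc' | hc'⟩ :=
    hv.exists_exchange (hx.isPos hX) hyp h hne hne' hB hlt
  · have hko := key_lt_key ho hv hov
    exact .step hy (ih o ho hko (hc'.trans h)) hv hc (key_lt_key hyp hv hlt) hko
  · rcases hco hx v o hv ho hc' with h' | h'
    · exact h'
    · exact .step hy h' hv hc (key_lt_key hyp hv hlt) (key_lt_key ho hv hov)

lemma Gen.of_inCone {X : Set V} (hX : ∀ x ∈ X, IsPos x) {x y : V} (hx : Gen X x) (hy : Gen X y)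
    (hcx : GenCoclosedAt X x) (hcy : GenCoclosedAt X y) (n : ℕ) :
    ∀ v, key v < n → IsPos v → InCone v x y → Gen X v := by
  induction n with
  | zero => intro v h; omega
  | succ n ih =>
    intro v hn hv h
    by_cases hne : v = x
    · rwa [hne]
    by_cases hne' : v = y
    · rwa [hne']
    rcases hv.lower_of_inCone (hx.isPos hX) (hy.isPos hX) h hne hne' with ⟨hB, hlt⟩ | ⟨hB, hlt⟩
    · exact hx.inCone_of_lower hX hy hv h hne hne' hB hlt hcx
        fun o ho hk hc => ih o (by omega) ho hc
    · exact hy.inCone_of_lower hX hx hv h.symm hne' hne hB hlt hcy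
        fun o ho hk hc => ih o (by omega) ho hc.symm

lemma Gen.false_of_lower {X : Set V} (hX : ∀ x ∈ X, IsPos x) {v a b : V} (hv : Gen X v)
    (ha : IsPos a) (hb : IsPos b) (h : InCone v a b) (hna : ¬ Gen X a) (hnb : ¬ Gen X b)
    (hB : 1 ≤ B v b) (hlt : ht b < ht v) (hco : ∀ o, key o < key v → GenCoclosedAt X o)
    {θ : V →ₗ[ℝ] ℝ} (hθ : Separates θ (initial (key v)) {o | Gen X o ∧ key o < key v})
    (hθv : 0 < θ v) : False := by
  have hvp := hv.isPos hX
  have hne : v ≠ a := by rintro rfl; exact hna hv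
  have hne' : v ≠ b := by rintro rfl; exact hnb hv
  have hneg {o : V} (ho : IsPos o) (hk : key o < key v) (hn : ¬ Gen X o) : θ o < 0 :=
    hθ.2 o ⟨ho, hk⟩ fun h => hn h.1
  have hkb := key_lt_key hb hvp hlt
  obtain ⟨o, ho, hov, hc, hc'⟩ := hvp.exists_exchange ha hb h hne hne' hB hlt
  have hko := key_lt_key ho hvp hov
  rcases lt_trichotomy (key a) (key v) with hka | hka | hka
  · exact absurd (h.map_neg hvp.ne_zero (hneg ha hka hna) (hneg hb hkb hnb)) hθv.not_gt
  · exact hne (key_injOn ha hvp hka).symm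
  · have hno : ¬ Gen X o := by
      intro hg
      rcases hc' with hc' | hc'
      · rcases hco o hko hg a b ha hb (hc'.trans h) with h' | h'
        exacts [hna h', hnb h']
      · exact hna (.step hv hg ha hc' hka (hko.trans hka))
    exact absurd (hc.map_neg hvp.ne_zero (hneg hb hkb hnb) (hneg ho hko hno)) hθv.not_gt

lemma genCoclosedAt {X : Set V} (hX : ∀ x ∈ X, IsPos x)
    (hco : ∀ v ∈ X, ∀ a b, IsPos a → IsPos b → InCone v a b → a ∈ X ∨ b ∈ X)
    (hsep : ∀ n, Separable (initial n)) (n : ℕ) : ∀ v, key v < n → GenCoclosedAt X v := by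
  induction n with
  | zero => intro v h; omega
  | succ n ih =>
    intro v hn hv a b ha hb h
    have ih' : ∀ o, key o < key v → GenCoclosedAt X o := fun o ho => ih o (by omega)
    cases hv with
    | base hv => exact (hco v hv a b ha hb h).imp Gen.base Gen.base
    | @step x y _ hx hy hvp hc hkx hky =>
      by_contra! hn
      obtain ⟨hna, hnb⟩ := hn
      have hv : Gen X v := .step hx hy hvp hc hkx hky
      obtain ⟨θ, hθ⟩ := hsep (key v) {o | Gen X o ∧ key o < key v}
        (fun o ho => ⟨ho.1.isPos hX, ho.2⟩)
        (fun c hc d hd o ho hcone => ⟨hc.1.of_inCone hX hd.1 (ih' _ hc.2) (ih' _ hd.2) (key v)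
          o ho.2 ho.1 hcone, ho.2⟩)
        (fun c hc d hd o ho hcone => ⟨ho, fun hg => by
          rcases ih' o ho.2 hg.1 c d hc.1.1 hd.1.1 hcone with h' | h'
          exacts [hc.2 ⟨h', hc.1.2⟩, hd.2 ⟨h', hd.1.2⟩]⟩)
      have hθv : 0 < θ v := hc.map_pos hvp.ne_zero (hθ.1 x ⟨hx, hkx⟩) (hθ.1 y ⟨hy, hky⟩)
      have hne : v ≠ a := by rintro rfl; exact hna hv
      have hne' : v ≠ b := by rintro rfl; exact hnb hv
      rcases hvp.lower_of_inCone ha hb h hne hne' with ⟨hB, hlt⟩ | ⟨hB, hlt⟩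
      · exact hv.false_of_lower hX ha hb h hna hnb hB hlt ih' hθ hθv
      · exact hv.false_of_lower hX hb ha h.symm hnb hna hB hlt ih' hθ hθv

lemma isClosedSet_iff {R : Set V} :
    IsClosedSet R ↔ ∀ a ∈ R, ∀ b ∈ R, ∀ v, IsPos v → InCone v a b → v ∈ R := by
  constructor
  · intro h a ha b hb v hv hc
    exact h a ha b hb ⟨mem_nnspan_pair.2 hc, mem_Φpos.2 hv⟩
  · rintro h a ha b hb v ⟨hc, hv⟩
    exact h a ha b hb v (mem_Φpos.1 hv) (mem_nnspan_pair.1 hc)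

lemma Gen.subset_closed {X C : Set V} (hX : X ⊆ C) (hC : IsClosedSet C) {v : V} (h : Gen X v) :
    v ∈ C := by
  induction h with
  | base h => exact hX h
  | step _ _ hv hc _ _ hx hy => exact isClosedSet_iff.1 hC _ hx _ hy _ hv hc

lemma isBiclosed_gen {X : Set V} (hX : ∀ x ∈ X, IsPos x)
    (hco : ∀ v ∈ X, ∀ a b, IsPos a → IsPos b → InCone v a b → a ∈ X ∨ b ∈ X)
    (hsep : ∀ n, Separable (initial n)) : IsBiclosed {v | Gen X v} := by
  have h (v) : GenCoclosedAt X v := genCoclosedAt hX hco hsep (key v + 1) v (by omega)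
  refine ⟨fun v hv => mem_Φpos.2 (hv.isPos hX), isClosedSet_iff.2 ?_, isClosedSet_iff.2 ?_⟩
  · intro a ha b hb v hv hc
    exact Gen.of_inCone hX ha hb (h a) (h b) (key v + 1) v (by omega) hv hc
  · rintro a ⟨ha, ha'⟩ b ⟨hb, hb'⟩ v hv hc
    refine ⟨mem_Φpos.2 hv, fun hg => ?_⟩
    rcases h v hg a b (mem_Φpos.1 ha) (mem_Φpos.1 hb) hc with h' | h'
    exacts [ha' h', hb' h']

lemma two_closure_of_union_is_join_of_separable (hsep : ∀ n, Separable (initial n))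
    {I : Type*} (R : I → Set V)
    (hR : ∀ i, IsBiclosed (R i)) (T : Set V)
    (hT : T = ⋂₀ {C : Set V | C ⊆ Φpos ∧ IsClosedSet C ∧ (⋃ i, R i) ⊆ C}) :
    IsBiclosed T ∧ (∀ i, R i ⊆ T) ∧
      ∀ B : Set V, IsBiclosed B → (∀ i, R i ⊆ B) → T ⊆ B := by
  have hbi : IsBiclosed {v | Gen (⋃ i, R i) v} := by
    refine isBiclosed_gen ?_ ?_ hsep
    · rintro x hx
      obtain ⟨i, hi⟩ := Set.mem_iUnion.1 hx
      exact mem_Φpos.1 ((hR i).1 hi)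
    · intro v hv a b ha hb hc
      obtain ⟨i, hi⟩ := Set.mem_iUnion.1 hv
      by_contra! hn
      have hna (c : V) (h : c ∉ ⋃ i, R i) : c ∉ R i := fun h' => h (Set.mem_iUnion.2 ⟨i, h'⟩)
      exact (isClosedSet_iff.1 (hR i).2.2 a ⟨mem_Φpos.2 ha, hna a hn.1⟩ b
        ⟨mem_Φpos.2 hb, hna b hn.2⟩ v (mem_Φpos.1 ((hR i).1 hi)) hc).2 hi
  have hTg : T = {v | Gen (⋃ i, R i) v} := by
    rw [hT]
    apply Set.Subset.antisymm
    · exact Set.sInter_subset_of_mem ⟨hbi.1, hbi.2.1, fun x hx => Gen.base hx⟩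
    · rintro v hv C ⟨-, hC, hXC⟩
      exact hv.subset_closed hXC hC
  refine ⟨hTg ▸ hbi, fun i x hx => ?_, fun C hC hRC => ?_⟩
  · rw [hTg]
    exact Gen.base (Set.mem_iUnion.2 ⟨i, hx⟩)
  · rw [hT]
    exact Set.sInter_subset_of_mem ⟨hC.1, hC.2.1, Set.iUnion_subset hRC⟩

/-! ### Isotropic frames -/

lemma exists_factorization {a c k : ℕ} (h : a * c = k * (k + 1)) :
    ∃ p q r s : ℕ, a = p * q ∧ c = r * s ∧ k = p * s ∧ k + 1 = q * r := by
  rcases a.eq_zero_or_pos with rfl | ha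
  · obtain rfl : k = 0 := by simpa using h.symm
    exact ⟨0, 1, 1, c, by simp⟩
  · have hg : 0 < a.gcd k := Nat.gcd_pos_of_pos_left _ ha
    obtain ⟨q, s, hqs, hq, hs⟩ := Nat.exists_coprime a k
    generalize a.gcd k = p at hg hq hs
    subst hq
    have hq0 : 0 < q := Nat.pos_of_mul_pos_right ha
    have h1 : q * c = s * (k + 1) := by
      apply Nat.eq_of_mul_eq_mul_left hg
      calc p * (q * c) = q * p * c := by ring
        _ = k * (k + 1) := h
        _ = p * (s * (k + 1)) := by conv_lhs => { arg 1; rw [hs] }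
                                    ring
    obtain ⟨r, hr⟩ : q ∣ k + 1 := hqs.dvd_of_dvd_mul_left (Dvd.intro _ h1)
    refine ⟨p, q, r, s, mul_comm _ _, ?_, by rw [hs, mul_comm], hr⟩
    apply Nat.eq_of_mul_eq_mul_left hq0
    rw [h1, hr]
    ring

lemma exists_factorization_int {a b c : ℤ} (ha : 0 ≤ a) (hc : 0 ≤ c) (h : b * b - 4 * a * c = 1) :
    ∃ p q r s : ℤ, a = p * q ∧ c = r * s ∧ b = p * s + q * r ∧ q * r - p * s = 1 := by
  lift a to ℕ using ha
  lift c to ℕ using hc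
  have hodd : ∃ k, b = 2 * k + 1 := by
    rcases b.even_or_odd with ⟨l, rfl⟩ | h
    · have : 2 * (2 * (l * l) - 2 * (a * c)) = (1 : ℤ) := by linarith
      omega
    · exact h
  obtain ⟨k, rfl⟩ := hodd
  rcases le_or_gt 0 k with hk | hk
  · lift k to ℕ using hk
    have h1 : (a : ℤ) * c = k * (k + 1) := by linarith
    obtain ⟨p, q, r, s, h1, h2, h3, h4⟩ := exists_factorization (by exact_mod_cast h1)
    have h3' : (k : ℤ) = p * s := by exact_mod_cast h3
    have h4' : (k : ℤ) + 1 = q * r := by exact_mod_cast h4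
    exact ⟨p, q, r, s, by exact_mod_cast h1, by exact_mod_cast h2, by linarith, by linarith⟩
  · obtain ⟨l, rfl⟩ : ∃ l : ℕ, k = -l - 1 := ⟨(-k - 1).toNat, by omega⟩
    have h1 : (a : ℤ) * c = l * (l + 1) := by linarith
    obtain ⟨p, q, r, s, h1, h2, h3, h4⟩ := exists_factorization (by exact_mod_cast h1)
    have h3' : (l : ℤ) = p * s := by exact_mod_cast h3
    have h4' : (l : ℤ) + 1 = q * r := by exact_mod_cast h4
    refine ⟨q, p, -s, -r, ?_, ?_, by linarith, by linarith⟩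
    · rw [h1]; push_cast; ring
    · rw [h2]; push_cast; ring

/-- A positive root `γ` with two integral isotropic vectors spanning its orthogonal plane. -/
structure Frame (γ n₀ n₁ : V) : Prop where
  pos : IsPos γ
  int₀ : IsInt n₀
  int₁ : IsInt n₁
  ht₀ : 0 ≤ ht n₀
  ht₁ : 0 ≤ ht n₁
  B₀₀ : B n₀ n₀ = 0
  B₁₁ : B n₁ n₁ = 0
  B₀γ : B n₀ γ = 0
  B₁γ : B n₁ γ = 0
  B₀₁ : B n₀ n₁ = -2

lemma Frame.symm {γ n₀ n₁ : V} (h : Frame γ n₀ n₁) : Frame γ n₁ n₀ :=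
  ⟨h.pos, h.int₁, h.int₀, h.ht₁, h.ht₀, h.B₁₁, h.B₀₀, h.B₁γ, h.B₀γ, by rw [B_comm, h.B₀₁]⟩

lemma IsPos.exists_frame {γ : V} (hγ : IsPos γ) : ∃ n₀ n₁, Frame γ n₀ n₁ := by
  obtain ⟨x, y, z, hx, hy, hz, -, -⟩ := hγ.exists_nat
  have hB := hγ.1.2
  have h : ((x : ℤ) - y - z) * (x - y - z) - 4 * y * z = 1 := by
    rw [B_eq, hx, hy, hz] at hB
    have : 2 * ((x : ℤ) * x + y * y + z * z) - (x + y + z) * (x + y + z) = 1 := by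
      exact_mod_cast hB
    linarith
  obtain ⟨p, q, r, s, h1, h2, h3, h4⟩ :=
    exists_factorization_int (Int.natCast_nonneg y) (Int.natCast_nonneg z) h
  have h1' : (y : ℝ) = p * q := by exact_mod_cast h1
  have h2' : (z : ℝ) = r * s := by exact_mod_cast h2
  have h3' : (x : ℝ) = (p + r) * (q + s) := by
    have : (x : ℤ) = (p + r) * (q + s) := by linarith
    exact_mod_cast this
  have h4' : (q : ℝ) * r - p * s = 1 := by exact_mod_cast h4
  rw [h3'] at hx
  rw [h1'] at hy
  rw [h2'] at hz
  have hint (p r : ℤ) : IsInt ![((p : ℝ) + r) ^ 2, (p : ℝ) ^ 2, (r : ℝ) ^ 2] := by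
    intro i
    fin_cases i
    · exact ⟨(p + r) ^ 2, by simp⟩
    · exact ⟨p ^ 2, by simp⟩
    · exact ⟨r ^ 2, by simp⟩
  refine ⟨![((p : ℝ) + r) ^ 2, (p : ℝ) ^ 2, (r : ℝ) ^ 2],
    ![((q : ℝ) + s) ^ 2, (q : ℝ) ^ 2, (s : ℝ) ^ 2], hγ, hint p r, hint q s, ?_, ?_, ?_, ?_, ?_, ?_,
    ?_⟩
  · simp only [ht_apply, Matrix.cons_val]; positivity
  · simp only [ht_apply, Matrix.cons_val]; positivity
  · simp only [B_eq, Matrix.cons_val]; ring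
  · simp only [B_eq, Matrix.cons_val]; ring
  · simp only [B_eq, Matrix.cons_val, hx, hy, hz]; ring
  · simp only [B_eq, Matrix.cons_val, hx, hy, hz]; ring
  · simp only [B_eq, Matrix.cons_val]
    linear_combination (-2 * ((q : ℝ) * r - p * s) - 2) * h4'

/-- The linear functional `-⟨·, n⟩ / 2`. -/
def co (n : V) : V →ₗ[ℝ] ℝ := (-1 / 2 : ℝ) • Bl n

lemma co_apply (n f : V) : co n f = -B f n / 2 := by
  simp only [co, LinearMap.smul_apply, Bl_apply, smul_eq_mul]; ring

namespace Frame

variable {γ n₀ n₁ : V}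

lemma decomp (h : Frame γ n₀ n₁) (f : V) :
    f = co n₀ f • n₁ + B f γ • γ + co n₁ f • n₀ := by
  have hli : LinearIndependent ℝ ![n₁, γ, n₀] := by
    rw [Fintype.linearIndependent_iff]
    intro g hg
    simp only [Fin.sum_univ_three, Matrix.cons_val] at hg
    have e0 := congrArg (B · n₀) hg
    have e1 := congrArg (B · n₁) hg
    have e2 := congrArg (B · γ) hg
    have z (x : V) : B 0 x = 0 := by simp [B_eq]
    simp only [B_add_left, B_smul_left, z, B_comm γ, h.B₀₀, h.B₁₁, h.B₀γ, h.B₁γ, h.B₀₁,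
      B_comm n₁ n₀, h.pos.1.2] at e0 e1 e2
    intro i
    fin_cases i
    · change g 0 = 0
      linarith
    · change g 1 = 0
      linarith
    · change g 2 = 0
      linarith
  have hspan : Submodule.span ℝ {n₁, γ, n₀} = ⊤ := by
    have := hli.span_eq_top_of_card_eq_finrank (by simp)
    rw [← this]
    congr 1
    ext v
    simp only [Matrix.range_cons, Matrix.range_empty, Set.union_empty, Set.mem_union,
      Set.mem_singleton_iff, Set.mem_insert_iff]
  have hf : f ∈ Submodule.span ℝ {n₁, γ, n₀} := hspan ▸ Submodule.mem_top
  obtain ⟨a, b, c, rfl⟩ := Submodule.mem_span_triple.1 hf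
  simp only [co_apply, B_add_left, B_smul_left, B_comm γ, h.B₀₀, h.B₁₁, h.B₀γ, h.B₁γ, h.B₀₁,
      B_comm n₁ n₀, h.pos.1.2]
  module

lemma B_eq_co (h : Frame γ n₀ n₁) (f g : V) :
    B f g = B f γ * B g γ - 2 * (co n₀ f * co n₁ g + co n₀ g * co n₁ f) := by
  conv_lhs => rw [h.decomp f]
  simp only [B_add_left, B_smul_left, co_apply, B_comm n₁ g, B_comm γ g, B_comm n₀ g]
  ring

lemma map_eq (h : Frame γ n₀ n₁) (θ : V →ₗ[ℝ] ℝ) (f : V) :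
    θ f = co n₀ f * θ n₁ + B f γ * θ γ + co n₁ f * θ n₀ := by
  conv_lhs => rw [h.decomp f]
  simp

lemma ht_mul (h : Frame γ n₀ n₁) : ht n₀ * ht n₁ = ht γ ^ 2 + 3 := by
  have e (x : V) : B ![1, 1, 1] x = -ht x := by
    simp only [B_eq, ht_apply, Matrix.cons_val]; ring
  have := h.B_eq_co ![1, 1, 1] ![1, 1, 1]
  simp only [co_apply, e, ht_apply ![1, 1, 1], Matrix.cons_val] at this
  linarith

lemma exists_ht (h : Frame γ n₀ n₁) : ∃ k : ℤ, ht n₀ = 2 * k := by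
  obtain ⟨k, m, n, hB, hm, hn⟩ := h.int₀.exists_B_eq h.int₀
  obtain rfl : m = n := by exact_mod_cast hm.symm.trans hn
  rw [h.B₀₀] at hB
  have hB : (0 : ℤ) = 2 * k - m * m := by exact_mod_cast hB
  have : Even (m * m) := ⟨k, by linarith⟩
  rcases Int.even_mul.1 this with h' | h' <;>
  · obtain ⟨l, rfl⟩ := h'
    exact ⟨l, by rw [hm]; push_cast; ring⟩

lemma exists_co (h : Frame γ n₀ n₁) {f : V} (hf : IsInt f) : ∃ k : ℤ, co n₀ f = k := by
  obtain ⟨k, m, n, hB, hm, hn⟩ := hf.exists_B_eq h.int₀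
  obtain ⟨l, hl⟩ := h.exists_ht
  refine ⟨m * l - k, ?_⟩
  rw [co_apply, hB, ← hn, hl]
  push_cast
  ring

lemma ht₀_pos (h : Frame γ n₀ n₁) : 0 < ht n₀ := by
  rcases h.ht₀.eq_or_lt with h0 | h0
  · have := h.ht_mul
    rw [← h0] at this
    nlinarith
  · exact h0

lemma lt_ht₁ (h : Frame γ n₀ n₁) (h0 : ht n₀ < ht γ) : ht γ < ht n₁ := by
  have := h.ht_mul
  by_contra! hle
  nlinarith [h.ht₀_pos, h.symm.ht₀_pos]

end Frame

lemma IsPos.exists_frame_lt {γ : V} (hγ : IsPos γ) (h1 : ht γ ≠ 1) :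
    ∃ n₀ n₁, Frame γ n₀ n₁ ∧ ht n₀ < ht γ := by
  obtain ⟨n₀, n₁, h⟩ := hγ.exists_frame
  have hne {m₀ m₁ : V} (h : Frame γ m₀ m₁) (hle : ht γ ≤ ht m₀) : ht γ + 1 ≤ ht m₀ := by
    obtain ⟨k, hk⟩ := h.exists_ht
    obtain ⟨l, hl⟩ := hγ.1.exists_ht
    rw [hk, hl] at hle ⊢
    have : 2 * l + 1 ≤ 2 * k := by exact_mod_cast hle
    have : 2 * l + 1 + 1 ≤ 2 * k := by omega
    exact_mod_cast this
  rcases lt_or_ge (ht n₀) (ht γ) with h0 | h0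
  · exact ⟨n₀, n₁, h, h0⟩
  rcases lt_or_ge (ht n₁) (ht γ) with h0' | h0'
  · exact ⟨n₁, n₀, h.symm, h0'⟩
  have := h.ht_mul
  have h2 : 1 < ht γ := lt_of_le_of_ne hγ.one_le_ht h1.symm
  nlinarith [mul_le_mul (hne h h0) (hne h.symm h0') (by linarith) h.ht₀]

/-! ### Roots pairing negatively with `γ` -/

/-- The situation in the inductive step of separability: `F` consists of the positive roots
before `γ`, `T ⊆ F` is biclosed relative to `F ∪ {γ}`, and `θ` separates `T` in `F` while having
the wrong sign on `γ`. -/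
structure Extension (F T : Set V) (γ n₀ n₁ : V) (θ : V →ₗ[ℝ] ℝ) : Prop where
  frame : Frame γ n₀ n₁
  finite : F.Finite
  isPos : ∀ f ∈ F, IsPos f
  mem_of_lt : ∀ f, IsPos f → ht f < ht γ → f ∈ F
  ht_le : ∀ f ∈ F, ht f ≤ ht γ
  not_mem : γ ∉ F
  subset : T ⊆ F
  closed : RelClosed (insert γ F) T
  coclosed : RelClosed (insert γ F) (insert γ F \ T)
  sep : Separates θ F T
  pos : 0 < θ γ

/-- The elements of `F ∪ -F` that pair negatively with `γ`. -/
def hat (F : Set V) (γ : V) : Set V := {f | (f ∈ F ∨ -f ∈ F) ∧ B f γ ≤ -1}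

namespace Extension

variable {F T : Set V} {γ n₀ n₁ : V} {θ : V →ₗ[ℝ] ℝ}

lemma symm (E : Extension F T γ n₀ n₁ θ) : Extension F T γ n₁ n₀ θ :=
  { E with frame := E.frame.symm }

lemma finite_hat (E : Extension F T γ n₀ n₁ θ) : (hat F γ).Finite := by
  refine (E.finite.union (E.finite.preimage (neg_injective.injOn (s := Neg.neg ⁻¹' F)))).subset ?_
  rintro f ⟨hf, -⟩
  exact hf

lemma isRt (E : Extension F T γ n₀ n₁ θ) {f : V} (hf : f ∈ hat F γ) : IsRt f := by
  rcases hf.1 with h | h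
  · exact (E.isPos f h).1
  · simpa using (E.isPos _ h).1.neg

lemma abs_ht_le (E : Extension F T γ n₀ n₁ θ) {f : V} (hf : f ∈ hat F γ) : |ht f| ≤ ht γ := by
  rcases hf.1 with h | h
  · rw [abs_of_pos (E.isPos f h).ht_pos]
    exact E.ht_le f h
  · have h1 := E.ht_le _ h
    have h2 := (E.isPos _ h).ht_pos
    rw [map_neg] at h1 h2
    rw [abs_of_neg (by linarith)]
    exact h1

lemma ne_zero_of_mem (E : Extension F T γ n₀ n₁ θ) {f : V} (hf : f ∈ F) : θ f ≠ 0 := by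
  by_cases h : f ∈ T
  · exact (E.sep.1 f h).ne'
  · exact (E.sep.2 f hf h).ne

lemma mem_of_pos (E : Extension F T γ n₀ n₁ θ) {f : V} (hf : f ∈ F) (h : 0 < θ f) : f ∈ T := by
  by_contra hT
  exact absurd (E.sep.2 f hf hT) h.not_gt

lemma ne_zero (E : Extension F T γ n₀ n₁ θ) {f : V} (hf : f ∈ hat F γ) : θ f ≠ 0 := by
  rcases hf.1 with h | h
  · exact E.ne_zero_of_mem h
  · simpa using E.ne_zero_of_mem h

lemma mem_hat (E : Extension F T γ n₀ n₁ θ) {f : V} (hf : IsRt f) (hB : B f γ ≤ -1)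
    (hlt : |ht f| < ht γ) : f ∈ hat F γ := by
  refine ⟨?_, hB⟩
  rw [abs_lt] at hlt
  rcases hf.pos_or with h | h
  · exact Or.inl (E.mem_of_lt f h hlt.2)
  · exact Or.inr (E.mem_of_lt _ h (by rw [map_neg]; linarith))

lemma exists_factors (E : Extension F T γ n₀ n₁ θ) {f : V} (hf : f ∈ hat F γ) :
    ∃ p q r s : ℕ, 1 ≤ q ∧ 1 ≤ r ∧ 1 ≤ p + s ∧ q * r = p * s + 1 ∧ co n₀ f = p * q ∧
      co n₁ f = r * s ∧ -B f γ = p * s + q * r := by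
  have hrt := E.isRt hf
  obtain ⟨a, ha⟩ := E.frame.exists_co hrt.1
  obtain ⟨c, hc⟩ := E.frame.symm.exists_co hrt.1
  obtain ⟨j, hj⟩ := hrt.exists_B E.frame.pos.1
  have hQ := E.frame.B_eq_co f f
  have hj1 : j ≤ -1 := by
    have h := hf.2
    rw [hj] at h
    have : 2 * j + 1 ≤ -1 := by exact_mod_cast h
    omega
  obtain ⟨k, rfl⟩ : ∃ k : ℕ, j = -k - 1 := ⟨(-j - 1).toNat, by omega⟩
  have hac : a * c = k * (k + 1) := by
    rw [hrt.2, ha, hc, hj] at hQ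
    have : (a * c : ℝ) = k * (k + 1) := by push_cast at hQ; linarith
    exact_mod_cast this
  have hht := E.abs_ht_le hf
  rw [E.frame.map_eq ht f, ha, hc, hj, abs_le] at hht
  push_cast at hht
  have hH := E.frame.pos.ht_pos
  have h0 := E.frame.ht₀_pos
  have h1 := E.frame.symm.ht₀_pos
  have hne : ¬ (a ≤ 0 ∧ c ≤ 0) := by
    rintro ⟨ha0, hc0⟩
    have ha' : (a : ℝ) ≤ 0 := by exact_mod_cast ha0
    have hc' : (c : ℝ) ≤ 0 := by exact_mod_cast hc0
    have e1 : (a : ℝ) * ht n₁ ≤ 0 := mul_nonpos_of_nonpos_of_nonneg ha' h1.le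
    have e2 : (c : ℝ) * ht n₀ ≤ 0 := mul_nonpos_of_nonpos_of_nonneg hc' h0.le
    have e3 : 0 ≤ (k : ℝ) * ht γ := by positivity
    have e4 : (a : ℝ) * ht n₁ = 0 := by linarith
    have e5 : (c : ℝ) * ht n₀ = 0 := by linarith
    have e6 : (k : ℝ) * ht γ = 0 := by linarith
    have a0 : (a : ℝ) = 0 := by simpa [h1.ne'] using e4
    have c0 : (c : ℝ) = 0 := by simpa [h0.ne'] using e5
    have k0 : (k : ℝ) = 0 := by simpa [hH.ne'] using e6
    have hfγ : f = -γ := by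
      rw [E.frame.decomp f, ha, hc, hj, a0, c0]
      push_cast
      rw [k0]
      module
    rcases hf.1 with h | h
    · have := (E.isPos f h).ht_pos
      rw [hfγ, map_neg] at this
      linarith
    · rw [hfγ, neg_neg] at h
      exact E.not_mem h
  have hk : 0 ≤ (k : ℤ) * (k + 1) := by positivity
  have hnn : 0 ≤ a ∧ 0 ≤ c := by
    rw [← hac, mul_nonneg_iff] at hk
    rcases hk with hk | hk
    · exact hk
    · exact absurd hk hne
  obtain ⟨ha0, hc0⟩ := hnn
  lift a to ℕ using ha0
  lift c to ℕ using hc0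
  obtain ⟨p, q, r, s, h1, h2, h3, h4⟩ := exists_factorization (by exact_mod_cast hac)
  have hqr : 0 < q * r := by omega
  have hps : 1 ≤ p + s := by
    by_contra! hcon
    obtain ⟨rfl, rfl⟩ : p = 0 ∧ s = 0 := by omega
    exact hne (by simp [h1, h2])
  refine ⟨p, q, r, s, Nat.pos_of_mul_pos_right hqr, Nat.pos_of_mul_pos_left hqr, hps, by omega,
    by rw [ha, h1]; push_cast; ring, by rw [hc, h2]; push_cast; ring, ?_⟩
  have h3' : (k : ℝ) = p * s := by exact_mod_cast h3
  have h4' : (k : ℝ) + 1 = q * r := by exact_mod_cast h4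
  rw [hj, ← h3', ← h4']
  push_cast
  ring

lemma co_nonneg (E : Extension F T γ n₀ n₁ θ) {f : V} (hf : f ∈ hat F γ) : 0 ≤ co n₀ f := by
  obtain ⟨p, q, r, s, -, -, -, -, h, -, -⟩ := E.exists_factors hf
  rw [h]
  positivity

lemma co_add_pos (E : Extension F T γ n₀ n₁ θ) {f : V} (hf : f ∈ hat F γ) :
    0 < co n₀ f + co n₁ f := by
  obtain ⟨p, q, r, s, hq, hr, hps, -, h, h', -⟩ := E.exists_factors hf
  rw [h, h']
  have : 0 < p * q + r * s := by
    rcases p.eq_zero_or_pos with rfl | hp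
    · have : 0 < s := by omega
      positivity
    · positivity
  exact_mod_cast this

lemma neg_of_eq (E : Extension F T γ n₀ n₁ θ) {f g : V} (hf : f ∈ hat F γ) (hg : g ∈ hat F γ)
    {k c : ℝ} (hk : 0 < k) (h : f = k • g + c • γ) (hneg : θ g < 0) : θ f < 0 := by
  have hγ := E.pos
  rcases le_or_gt c 0 with hc | hc
  · rw [h, map_add, map_smul, map_smul, smul_eq_mul, smul_eq_mul]
    nlinarith
  refine (E.ne_zero hf).lt_or_gt.resolve_right fun hpos => ?_
  have hγT : γ ∉ T := fun h => E.not_mem (E.subset h)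
  rcases hf.1 with hfF | hfF <;> rcases hg.1 with hgF | hgF
  · have hgT : g ∉ T := fun h' => absurd (E.sep.1 g h') hneg.not_gt
    exact (E.coclosed g ⟨Or.inr hgF, hgT⟩ γ ⟨Or.inl rfl, hγT⟩ f (Or.inr hfF)
      ⟨k, c, hk.le, hc.le, h⟩).2 (E.mem_of_pos hfF hpos)
  · have hgT : -g ∈ T := E.mem_of_pos hgF (by simpa using hneg)
    refine hγT (E.closed f (E.mem_of_pos hfF hpos) _ hgT γ (Or.inl rfl)
      ⟨c⁻¹, c⁻¹ * k, by positivity, by positivity, ?_⟩)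
    rw [h, smul_add, smul_smul, smul_smul, inv_mul_cancel₀ hc.ne']
    module
  · have h1 := (E.isPos _ hfF).ht_pos
    have h2 := (E.isPos _ hgF).ht_pos
    rw [h] at h1
    simp only [map_neg, map_add, map_smul, smul_eq_mul] at h1
    nlinarith [mul_pos hk h2, mul_pos hc E.frame.pos.ht_pos]
  · have hfT : -f ∉ T := fun h' => by
      have := E.sep.1 _ h'
      rw [map_neg] at this
      linarith
    refine (E.coclosed _ ⟨Or.inr hfF, hfT⟩ γ ⟨Or.inl rfl, hγT⟩ (-g) (Or.inr hgF)
      ⟨k⁻¹, k⁻¹ * c, by positivity, by positivity, ?_⟩).2 (E.mem_of_pos hgF (by simpa using hneg))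
    rw [h, smul_neg, smul_add, smul_smul, smul_smul, inv_mul_cancel₀ hk.ne']
    module

/-- The sign of `θ` on `hat F γ` depends only on the projection along `γ`, up to scaling. -/
lemma neg_of_proportional (E : Extension F T γ n₀ n₁ θ) {f g : V} (hf : f ∈ hat F γ)
    (hg : g ∈ hat F γ) (h : co n₀ f * co n₁ g = co n₀ g * co n₁ f) (hneg : θ g < 0) :
    θ f < 0 := by
  have hf' := E.co_add_pos hf
  have hg' := E.co_add_pos hg
  obtain ⟨k, hk, e0, e1⟩ : ∃ k : ℝ, 0 < k ∧ co n₀ f = k * co n₀ g ∧ co n₁ f = k * co n₁ g := by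
    refine ⟨_, div_pos hf' hg', ?_, ?_⟩ <;> field_simp <;> linarith
  refine E.neg_of_eq hf hg hk (c := B f γ - k * B g γ) ?_ hneg
  have df := E.frame.decomp f
  have dg := E.frame.decomp g
  rw [e0, e1] at df
  linear_combination (norm := module) df - k • dg

lemma pos_of_proportional (E : Extension F T γ n₀ n₁ θ) {f g : V} (hf : f ∈ hat F γ)
    (hg : g ∈ hat F γ) (h : co n₀ f * co n₁ g = co n₀ g * co n₁ f) (hpos : 0 < θ g) :
    0 < θ f :=
  (E.ne_zero hf).lt_or_gt.resolve_left fun hneg =>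
    absurd (E.neg_of_proportional hg hf h.symm hneg) hpos.not_gt

end Extension

namespace Extension

variable {F T : Set V} {γ n₀ n₁ : V} {θ : V →ₗ[ℝ] ℝ}

lemma ht_mul_eq (E : Extension F T γ n₀ n₁ θ) {f : V} {p q r s : ℝ}
    (ha : co n₀ f = p * q) (hc : co n₁ f = r * s) (hb : -B f γ = p * s + q * r) :
    ht f * ht n₀ = (ht n₀ * r - ht γ * p) * (ht n₀ * s - ht γ * q) + 3 * (p * q) := by
  rw [E.frame.map_eq ht f, ha, hc, ← neg_neg (B f γ), hb]
  linear_combination (p * q) * E.frame.ht_mul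

lemma co_translate (E : Extension F T γ n₀ n₁ θ) (t : ℝ) :
    co n₀ (t • n₀ - γ) = 0 ∧ co n₁ (t • n₀ - γ) = t ∧ B (t • n₀ - γ) γ = -1 := by
  simp only [co_apply, B_sub_left, B_smul_left, B_comm γ, E.frame.B₀₀, E.frame.B₀₁, E.frame.B₀γ,
    E.frame.B₁γ, E.frame.pos.1.2]
  norm_num

lemma translate_mem_hat (E : Extension F T γ n₀ n₁ θ) (n : ℕ) (hn : 1 ≤ n)
    (hlt : n * ht n₀ < 2 * ht γ) : (n : ℝ) • n₀ - γ ∈ hat F γ := by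
  refine E.mem_hat ⟨?_, ?_⟩ (E.co_translate n).2.2.le ?_
  · have := E.frame.int₀.smul n
    push_cast at this
    exact this.sub E.frame.pos.1.1
  · simp only [B_sub_left, B_sub_right, B_smul_left, B_smul_right, E.frame.B₀₀, B_comm γ n₀,
      E.frame.B₀γ, E.frame.pos.1.2]
    ring
  · rw [map_sub, map_smul, smul_eq_mul, abs_lt]
    have := E.frame.ht₀_pos
    have : 0 < (n : ℝ) * ht n₀ := by positivity
    constructor <;> linarith

lemma le_of_pos (E : Extension F T γ n₀ n₁ θ) (h0 : ht n₀ < ht γ) (hν : θ n₀ < θ γ) {f : V}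
    (hf : f ∈ hat F γ) (hpos : 0 < θ f) : 2 * (θ n₀ * co n₁ f) ≤ θ γ * (-B f γ + 1) := by
  obtain ⟨p, q, r, s, hq, hr, hps, hqr, ha, hc, hb⟩ := E.exists_factors hf
  have hqr' : (q : ℝ) * r = p * s + 1 := by exact_mod_cast hqr
  have hr0 : (0 : ℝ) ≤ r := by positivity
  have hm := E.pos
  suffices hsuff : θ n₀ * s ≤ θ γ * q by
    rw [hc, hb]
    nlinarith
  by_contra! hcon
  have hq' : (1 : ℝ) ≤ q := by exact_mod_cast hq
  have hν0 : 0 < θ n₀ := by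
    by_contra! hle
    nlinarith [mul_nonneg (neg_nonneg.2 hle) (Nat.cast_nonneg (α := ℝ) s)]
  have h1 : ((1 : ℕ) : ℝ) • n₀ - γ ∈ hat F γ :=
    E.translate_mem_hat 1 le_rfl (by push_cast; linarith [E.frame.pos.ht_pos])
  have hneg : θ (((1 : ℕ) : ℝ) • n₀ - γ) < 0 := by
    rw [map_sub, map_smul, smul_eq_mul]
    push_cast
    linarith
  rcases p.eq_zero_or_pos with hp | hp
  · refine absurd (E.neg_of_proportional hf h1 ?_ hneg) hpos.not_gt
    rw [ha, hp, (E.co_translate _).1]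
    simp
  have hp' : (1 : ℝ) ≤ p := by exact_mod_cast hp
  have hsmall {n : ℕ} (hn : (n : ℝ) • n₀ - γ ∈ hat F γ) : n * θ n₀ < θ γ := by
    have := E.neg_of_proportional hn h1
      (by rw [(E.co_translate _).1, (E.co_translate _).1, zero_mul, zero_mul]) hneg
    rw [map_sub, map_smul, smul_eq_mul] at this
    linarith
  have hall (n : ℕ) (hn : 1 ≤ n) : (n : ℝ) • n₀ - γ ∈ hat F γ := by
    induction n, hn using Nat.le_induction with
    | base => exact h1
    | succ n hn ih =>
      have hn' : (1 : ℝ) ≤ n := by exact_mod_cast hn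
      refine E.translate_mem_hat _ (by omega) ?_
      push_cast
      by_contra! hge
      have hs : n * q < s := by
        have h2 : θ n₀ * (n * q) < θ n₀ * s := by nlinarith [hsmall ih]
        exact_mod_cast lt_of_mul_lt_mul_left h2 hν0.le
      have hr1 : n * p < r := by
        by_contra! hle
        nlinarith [Nat.mul_le_mul_left q hle, Nat.mul_le_mul_left p hs]
      have hs' : (n : ℝ) * q + 1 ≤ s := by exact_mod_cast hs
      have hr' : (n : ℝ) * p + 1 ≤ r := by exact_mod_cast hr1
      have hη := E.frame.ht₀_pos
      have hH := E.frame.pos.ht_pos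
      have key {x y : ℝ} (hx : 1 ≤ x) (hy : n * x + 1 ≤ y) : ht γ ≤ ht n₀ * y - ht γ * x := by
        have e1 : ht n₀ * (n * x + 1) ≤ ht n₀ * y := mul_le_mul_of_nonneg_left hy hη.le
        have e2 : 2 * ht γ * (n * x + 1) ≤ (n + 1) * ht n₀ * (n * x + 1) :=
          mul_le_mul_of_nonneg_right hge (by positivity)
        have e3 : 0 ≤ ht γ * ((n - 1) * (x - 1)) := by
          apply mul_nonneg hH.le
          apply mul_nonneg <;> linarith
        have e4 : (n + 1) * (ht γ * (x + 1)) ≤ (n + 1) * (ht n₀ * (n * x + 1)) := by linarith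
        have e5 := le_of_mul_le_mul_left e4 (by linarith)
        linarith
      have hprod := mul_le_mul (key hp' hr') (key hq' hs') hH.le (hH.le.trans (key hp' hr'))
      have hfe := E.ht_mul_eq ha hc hb
      have hfle := (le_abs_self _).trans (E.abs_ht_le hf)
      have h3 : ht f * ht n₀ ≤ ht γ * ht n₀ := mul_le_mul_of_nonneg_right hfle hη.le
      have h4 : ht γ * ht n₀ < ht γ * ht γ := mul_lt_mul_of_pos_left h0 hH
      nlinarith [mul_nonneg (zero_le_one.trans hp') (zero_le_one.trans hq')]
  obtain ⟨n, hn⟩ := exists_nat_gt (θ γ / θ n₀)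
  rw [div_lt_iff₀ hν0] at hn
  have hn1 : 1 ≤ n := by
    by_contra! h
    obtain rfl : n = 0 := by omega
    simp at hn
    linarith
  exact absurd (hsmall (hall n hn1)) hn.not_gt

lemma factor_le (E : Extension F T γ n₀ n₁ θ) (h0 : ht n₀ < ht γ) {f : V} (hf : f ∈ hat F γ)
    {p q r s : ℕ} (hr : 1 ≤ r) (hqr : q * r = p * s + 1) (ha : co n₀ f = p * q)
    (hc : co n₁ f = r * s) (hb : -B f γ = p * s + q * r) : p ≤ r := by
  by_contra! hcon
  have hq : s < q := by
    by_contra! hle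
    nlinarith [Nat.mul_le_mul_right r hle, Nat.mul_le_mul_right s hcon]
  have hp' : (r : ℝ) + 1 ≤ p := by exact_mod_cast hcon
  have hq' : (s : ℝ) + 1 ≤ q := by exact_mod_cast hq
  have hr' : (1 : ℝ) ≤ r := by exact_mod_cast hr
  have hs' : (0 : ℝ) ≤ s := by positivity
  have hH := E.frame.pos.ht_pos
  have hη := E.frame.lt_ht₁ h0
  have hfe := E.symm.ht_mul_eq (p := s) (q := r) (r := q) (s := p) (by rw [hc, mul_comm])
    (by rw [ha, mul_comm]) (by rw [hb]; ring)
  have key {x y : ℝ} (hx : 0 ≤ x) (hy : x + 1 ≤ y) : ht n₁ ≤ ht n₁ * y - ht γ * x := by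
    nlinarith [mul_le_mul_of_nonneg_left hy (hH.trans hη).le, mul_nonneg hx (sub_nonneg.2 hη.le)]
  have hprod := mul_le_mul (key hs' hq') (key (zero_le_one.trans hr') hp') (hH.trans hη).le
    ((hH.trans hη).le.trans (key hs' hq'))
  have hfle := (le_abs_self _).trans (E.abs_ht_le hf)
  have h3 : ht f * ht n₁ ≤ ht γ * ht n₁ := mul_le_mul_of_nonneg_right hfle (hH.trans hη).le
  have h4 : ht γ * ht n₁ < ht n₁ * ht n₁ := mul_lt_mul_of_pos_right hη (hH.trans hη)
  nlinarith [mul_nonneg hs' (zero_le_one.trans hr')]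

lemma mul_co_le (E : Extension F T γ n₀ n₁ θ) (h0 : ht n₀ < ht γ) (hlam : θ n₁ ≤ θ γ) {f : V}
    (hf : f ∈ hat F γ) : 2 * (θ n₁ * co n₀ f) ≤ θ γ * (-B f γ + 1) := by
  obtain ⟨p, q, r, s, hq, hr, hps, hqr, ha, hc, hb⟩ := E.exists_factors hf
  have hpr : (p : ℝ) ≤ r := by exact_mod_cast E.factor_le h0 hf hr hqr ha hc hb
  have hqr' : (q : ℝ) * r = p * s + 1 := by exact_mod_cast hqr
  have hm := E.pos
  have h1 : θ n₁ * p ≤ θ γ * r :=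
    (mul_le_mul_of_nonneg_right hlam (by positivity)).trans (mul_le_mul_of_nonneg_left hpr hm.le)
  have h2 := mul_le_mul_of_nonneg_left h1 (Nat.cast_nonneg (α := ℝ) q)
  rw [ha, hb]
  nlinarith

lemma pos_of_lt (E : Extension F T γ n₀ n₁ θ) (h0 : ht n₀ < ht γ) (hlam : θ γ < θ n₁)
    (hν : θ γ < θ n₀) {f : V} (hf : f ∈ hat F γ) : 0 < θ f := by
  obtain ⟨p, q, r, s, hq, hr, hps, hqr, ha, hc, hb⟩ := E.exists_factors hf
  have hpr := E.factor_le h0 hf hr hqr ha hc hb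
  have h1 : p * s + q * r ≤ p * q + r * s := by
    rcases hpr.eq_or_lt with rfl | hlt
    · nlinarith
    · have : q ≤ s := by
        by_contra! hle
        nlinarith [Nat.mul_le_mul hle hlt]
      obtain ⟨i, rfl⟩ := Nat.exists_eq_add_of_le hpr
      obtain ⟨j, rfl⟩ := Nat.exists_eq_add_of_le this
      nlinarith [Nat.zero_le (i * j)]
  have h1' : (p : ℝ) * s + q * r ≤ p * q + r * s := by exact_mod_cast h1
  have hsum := E.co_add_pos hf
  rw [E.frame.map_eq θ f, ← neg_neg (B f γ), hb]
  rw [ha, hc] at hsum ⊢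
  have hm := E.pos
  have ha0 : (0 : ℝ) ≤ p * q := by positivity
  have hc0 : (0 : ℝ) ≤ r * s := by positivity
  rcases ha0.eq_or_lt with ha0 | ha0
  · rw [← ha0] at hsum h1' ⊢
    nlinarith
  · nlinarith [mul_pos (sub_pos.2 hlam) ha0, mul_nonneg (sub_pos.2 hν).le hc0]

end Extension

lemma exists_roots {a b c : ℝ} (hc : 0 < c) (hb : 1 ≤ b) (hQ : b ^ 2 = 4 * (a * c) + 1) :
    ∃ x₁ x₂ : ℝ, 0 ≤ x₁ ∧ c * x₂ = c * x₁ + 1 ∧ b = c * x₁ + c * x₂ ∧ a = c * (x₁ * x₂) := by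
  refine ⟨(b - 1) / (2 * c), (b + 1) / (2 * c), div_nonneg (by linarith) (by linarith), ?_, ?_, ?_⟩
  · field_simp
    ring
  · field_simp
    ring
  · field_simp
    linarith

lemma nonpos_of_le {x₁ x₂ y₁ y₂ l m ν : ℝ} (hx : x₁ < x₂) (hxy : x₂ ≤ y₁) (hy : y₁ < y₂)
    (hlx : l * x₂ ≤ m) (hly : l * y₁ ≤ m) (h : l * (x₁ * x₂) - m * (x₁ + x₂) + ν < 0) :
    l * (y₁ * y₂) - m * (y₁ + y₂) + ν < 0 := by
  have h1 : 0 ≤ (y₁ - x₁) * (m - l * x₂) :=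
    mul_nonneg (by linarith) (by linarith)
  have h2 : 0 ≤ (y₂ - x₂) * (m - l * y₁) :=
    mul_nonneg (by linarith) (by linarith)
  linarith

lemma le_of_product {x₁ x₂ y₁ y₂ : ℝ} (hx₁ : 0 ≤ x₁) (hy₁ : 0 ≤ y₁) (hlt : x₁ * x₂ < y₁ * y₂)
    (h : (y₂ - x₁) * (x₂ - y₁) ≤ 0) : x₂ ≤ y₁ := by
  by_contra! hc
  have h1 : y₂ ≤ x₁ := by
    by_contra! h'
    exact absurd (mul_pos (sub_pos.2 h') (sub_pos.2 hc)) h.not_gt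
  linarith [mul_le_mul h1 hc.le hy₁ hx₁]

/-- Two quadratics `c X² - b X + a` of discriminant one with incomparable root intervals and
ordered constant terms cannot be separated by a functional of bounded slope. -/
lemma false_of_incomparable {a b c a' b' c' l m ν : ℝ} (ha : 0 ≤ a) (hc : 0 ≤ c)
    (hc' : 0 ≤ c') (hb : 1 ≤ b) (hb' : 1 ≤ b') (hQ : b ^ 2 = 4 * (a * c) + 1)
    (hQ' : b' ^ 2 = 4 * (a' * c') + 1) (hB : b * b' - 2 * (a * c' + a' * c) ≤ -1)
    (hlt : a * c' < a' * c) (hneg : l * a - m * b + ν * c < 0)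
    (hpos : 0 < l * a' - m * b' + ν * c') (hm : 0 < m) (hle : 2 * (l * a') ≤ m * (b' + 1)) :
    False := by
  have hac' : 0 ≤ a * c' := mul_nonneg ha hc'
  have hc0 : 0 < c := hc.lt_of_ne (by rintro rfl; linarith)
  rcases hc'.eq_or_lt with rfl | hc0'
  · have : b' = 1 := by nlinarith
    subst this
    linarith
  obtain ⟨x₁, x₂, hx₁, hx₁₂, hxb, hxa⟩ := exists_roots hc0 hb hQ
  obtain ⟨y₁, y₂, hy₁, hy₁₂, hyb, hya⟩ := exists_roots hc0' hb' hQ'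
  have hx : x₁ < x₂ := lt_of_mul_lt_mul_left (by linarith) hc
  have hy : y₁ < y₂ := lt_of_mul_lt_mul_left (by linarith) hc'
  have hcc : 0 < c * c' := mul_pos hc0 hc0'
  have hprod : (y₂ - x₁) * (x₂ - y₁) ≤ 0 := by
    have : 2 * (c * c') * ((y₂ - x₁) * (x₂ - y₁)) =
        b * b' - 2 * (a * c' + a' * c) + 1 := by
      rw [hxa, hxb, hya, hyb]
      linear_combination (c * x₂ - c * x₁) * hy₁₂ + hx₁₂
    by_contra! h
    linarith [mul_pos hcc h]
  have hlt' : x₁ * x₂ < y₁ * y₂ := by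
    have : c * c' * (x₁ * x₂) < c * c' * (y₁ * y₂) := by
      rw [hxa, hya] at hlt
      linarith
    exact lt_of_mul_lt_mul_left this hcc.le
  have hxy : x₂ ≤ y₁ := le_of_product hx₁ hy₁ hlt' hprod
  have hly : l * y₁ ≤ m := by
    have h1 : (c' * y₂) * (l * y₁) ≤ (c' * y₂) * m := by
      have : b' + 1 = 2 * (c' * y₂) := by linarith
      rw [hya, this] at hle
      linarith
    exact le_of_mul_le_mul_left h1 (mul_pos hc0' (hy₁.trans_lt hy))
  have hlx : l * x₂ ≤ m := by
    rcases le_total l 0 with h | h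
    · exact (mul_nonpos_of_nonpos_of_nonneg h (hx₁.trans hx.le)).trans hm.le
    · exact (mul_le_mul_of_nonneg_left hxy h).trans hly
  have e1 : l * (x₁ * x₂) - m * (x₁ + x₂) + ν < 0 := by
    have : c * (l * (x₁ * x₂) - m * (x₁ + x₂) + ν) < c * 0 := by
      rw [hxa, hxb] at hneg
      linarith
    exact lt_of_mul_lt_mul_left this hc
  have e2 : 0 < l * (y₁ * y₂) - m * (y₁ + y₂) + ν := by
    have : c' * 0 < c' * (l * (y₁ * y₂) - m * (y₁ + y₂) + ν) := by
      rw [hya, hyb] at hpos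
      linarith
    exact lt_of_mul_lt_mul_left this hc'
  exact (nonpos_of_le hx hxy hy hlx hly e1).not_gt e2

namespace Extension

variable {F T : Set V} {γ n₀ n₁ : V} {θ : V →ₗ[ℝ] ℝ}

/-- The area form on the projections along `γ`. -/
def cross (n₀ n₁ u v : V) : ℝ := co n₀ u * co n₁ v - co n₀ v * co n₁ u

lemma exists_mem (E : Extension F T γ n₀ n₁ θ) {f : V} (hf : f ∈ hat F γ) :
    ∃ g ∈ F, g ∈ hat F γ ∧ ∃ t : ℝ, 0 < t ∧ co n₀ g = t * co n₀ f ∧ co n₁ g = t * co n₁ f := by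
  rcases hf.1 with h | h
  · exact ⟨f, h, hf, 1, one_pos, by simp, by simp⟩
  have hpf := E.isPos _ h
  have hγ := E.frame.pos
  have hB : 1 ≤ B (-f) γ := by
    rw [B_neg_left]
    linarith [hf.2]
  have hlt : ht (-f) < ht γ := (E.ht_le _ h).lt_of_ne fun he =>
    E.not_mem (hpf.eq_of_ht_eq hγ hB he ▸ h)
  obtain ⟨g, hg, hgγ, p, q, hp, hq, he⟩ := hpf.exists_ancestor hγ hB hlt
  have hgF := E.mem_of_lt g hg hgγ
  have hg' : q • g = γ + p • f := by
    rw [he]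
    module
  have hgB : B g γ ≤ -1 := by
    apply hg.1.B_le hγ.1
    have := congrArg (B · γ) hg'
    simp only [B_add_left, B_smul_left, hγ.1.2] at this
    by_contra! h
    nlinarith [mul_pos hq h, hf.2]
  have hco {n : V} (hn : B n γ = 0) : co n g = p / q * co n f := by
    have := congrArg (co n) hg'
    simp only [map_add, map_smul, smul_eq_mul, co_apply n γ, B_comm γ, hn] at this
    field_simp
    linarith
  exact ⟨g, hgF, ⟨Or.inl hgF, hgB⟩, p / q, div_pos (by linarith) hq, hco E.frame.B₀γ,
    hco E.frame.B₁γ⟩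

lemma mem_hat_or (E : Extension F T γ n₀ n₁ θ) {f : V} (hf : f ∈ F) :
    f ∈ hat F γ ∨ -f ∈ hat F γ := by
  rcases (E.isPos f hf).1.B_or E.frame.pos.1 with h | h
  · exact Or.inr ⟨Or.inr (by simpa using hf), by rw [B_neg_left]; linarith⟩
  · exact Or.inl ⟨Or.inl hf, h⟩

/-- The slope of the projection of `f` along `γ`. -/
def slope (n₀ n₁ f : V) : ℝ := co n₀ f / (co n₀ f + co n₁ f)

lemma slope_le_slope (E : Extension F T γ n₀ n₁ θ) {f g : V} (hf : f ∈ hat F γ)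
    (hg : g ∈ hat F γ) : slope n₀ n₁ f ≤ slope n₀ n₁ g ↔ cross n₀ n₁ f g ≤ 0 := by
  rw [slope, slope, div_le_div_iff₀ (E.co_add_pos hf) (E.co_add_pos hg), cross]
  constructor <;> intro h <;> linarith

lemma cross_nonneg_of_extremal (E : Extension F T γ n₀ n₁ θ)
    (hle : ∀ f ∈ hat F γ, 0 < θ f → 2 * (θ n₁ * co n₀ f) ≤ θ γ * (-B f γ + 1)) {g h : V}
    (hgF : g ∈ F) (hhF : h ∈ F) (hg : g ∈ hat F γ) (hh : h ∈ hat F γ) (hθg : θ g < 0)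
    (hθh : 0 < θ h) (hmin : ∀ o ∈ hat F γ, θ o < 0 → cross n₀ n₁ g o ≤ 0)
    (hmax : ∀ o ∈ hat F γ, 0 < θ o → cross n₀ n₁ o h ≤ 0) : 0 ≤ cross n₀ n₁ g h := by
  by_contra! hlt
  have hpg := E.isPos g hgF
  have hph := E.isPos h hhF
  rcases hph.1.B_or hpg.1 with hB | hB
  · rcases lt_trichotomy (ht h) (ht g) with hht | hht | hht
    · obtain ⟨o, ho, hog, p, q, hp, hq, he⟩ := hph.exists_ancestor hpg hB hht
      have hoF := E.mem_of_lt o ho (hog.trans_le (E.ht_le g hgF))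
      have hθo : θ o < 0 := by
        have := congrArg θ he
        simp only [map_add, map_smul, smul_eq_mul] at this
        by_contra! hn
        nlinarith [mul_nonneg hq.le hn]
      have e0 := congrArg (co n₀) he
      have e1 := congrArg (co n₁) he
      simp only [map_add, map_smul, smul_eq_mul] at e0 e1
      rcases E.mem_hat_or hoF with ho' | ho'
      · have h1 := hmin o ho' hθo
        have h2 : q * cross n₀ n₁ g o = -(p * cross n₀ n₁ g h) := by
          simp only [cross, e0, e1]
          ring
        nlinarith
      · have h1 := hmax (-o) ho' (by simpa using hθo)
        have h2 : q * cross n₀ n₁ (-o) h = -cross n₀ n₁ g h := by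
          simp only [cross, e0, e1, map_neg]
          ring
        nlinarith
    · rw [hph.eq_of_ht_eq hpg hB hht] at hθh
      linarith
    · rw [B_comm] at hB
      obtain ⟨o, ho, hoh, p, q, hp, hq, he⟩ := hpg.exists_ancestor hph hB hht
      have hoF := E.mem_of_lt o ho (hoh.trans_le (E.ht_le h hhF))
      have hθo : 0 < θ o := by
        have := congrArg θ he
        simp only [map_add, map_smul, smul_eq_mul] at this
        by_contra! hn
        nlinarith [mul_nonneg hq.le (neg_nonneg.2 hn)]
      have e0 := congrArg (co n₀) he
      have e1 := congrArg (co n₁) he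
      simp only [map_add, map_smul, smul_eq_mul] at e0 e1
      rcases E.mem_hat_or hoF with ho' | ho'
      · have h1 := hmax o ho' hθo
        have h2 : q * cross n₀ n₁ o h = -(p * cross n₀ n₁ g h) := by
          simp only [cross, e0, e1]
          ring
        nlinarith
      · have h1 := hmin (-o) ho' (by simpa using hθo)
        have h2 : q * cross n₀ n₁ g (-o) = -cross n₀ n₁ g h := by
          simp only [cross, e0, e1, map_neg]
          ring
        nlinarith
  · have hQg := E.frame.B_eq_co g g
    have hQh := E.frame.B_eq_co h h
    rw [hpg.1.2] at hQg
    rw [hph.1.2] at hQh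
    rw [E.frame.B_eq_co h g] at hB
    rw [E.frame.map_eq] at hθg hθh
    rw [cross] at hlt
    exact false_of_incomparable (l := θ n₁) (m := θ γ) (ν := θ n₀) (E.co_nonneg hg)
      (E.symm.co_nonneg hg) (E.symm.co_nonneg hh) (b := -B g γ) (b' := -B h γ)
      (by linarith [hg.2]) (by linarith [hh.2]) (by linarith) (by linarith) (by linarith)
      (by linarith) (by linarith) (by linarith) E.pos (hle h hh (by rwa [E.frame.map_eq]))

lemma slope_lt_slope (E : Extension F T γ n₀ n₁ θ)
    (hle : ∀ f ∈ hat F γ, 0 < θ f → 2 * (θ n₁ * co n₀ f) ≤ θ γ * (-B f γ + 1)) {h g : V}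
    (hh : h ∈ hat F γ) (hg : g ∈ hat F γ) (hθh : 0 < θ h) (hθg : θ g < 0) :
    slope n₀ n₁ h < slope n₀ n₁ g := by
  obtain ⟨h', ⟨hh', hθh'⟩, hmax⟩ := Set.exists_max_image {f ∈ hat F γ | 0 < θ f} (slope n₀ n₁)
    (E.finite_hat.subset (Set.sep_subset _ _)) ⟨h, hh, hθh⟩
  obtain ⟨g', ⟨hg', hθg'⟩, hmin⟩ := Set.exists_min_image {f ∈ hat F γ | θ f < 0} (slope n₀ n₁)
    (E.finite_hat.subset (Set.sep_subset _ _)) ⟨g, hg, hθg⟩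
  obtain ⟨h'', hF₁, hhat₁, t, ht, e0, e1⟩ := E.exists_mem hh'
  obtain ⟨g'', hF₂, hhat₂, u, hu, d0, d1⟩ := E.exists_mem hg'
  have hneg := E.neg_of_proportional hhat₂ hg' (by rw [d0, d1]; ring) hθg'
  have hpos := E.pos_of_proportional hhat₁ hh' (by rw [e0, e1]; ring) hθh'
  have key := E.cross_nonneg_of_extremal hle hF₂ hF₁ hhat₂ hhat₁ hneg hpos
    (fun o ho hθo => by
      have h1 := (E.slope_le_slope hg' ho).1 (hmin o ⟨ho, hθo⟩)
      have h2 : cross n₀ n₁ g'' o = u * cross n₀ n₁ g' o := by simp only [cross, d0, d1]; ring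
      rw [h2]
      exact mul_nonpos_of_nonneg_of_nonpos hu.le h1)
    (fun o ho hθo => by
      have h1 := (E.slope_le_slope ho hh').1 (hmax o ⟨ho, hθo⟩)
      have h2 : cross n₀ n₁ o h'' = t * cross n₀ n₁ o h' := by simp only [cross, e0, e1]; ring
      rw [h2]
      exact mul_nonpos_of_nonneg_of_nonpos ht.le h1)
  have key' : 0 ≤ cross n₀ n₁ g' h' := by
    have h2 : cross n₀ n₁ g'' h'' = u * t * cross n₀ n₁ g' h' := by
      simp only [cross, d0, d1, e0, e1]; ring
    rw [h2] at key
    exact nonneg_of_mul_nonneg_right key (mul_pos hu ht)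
  have hne : cross n₀ n₁ g' h' ≠ 0 := fun h0 => by
    have := E.neg_of_proportional hh' hg' (by rw [cross] at h0; linarith) hθg'
    linarith
  have hlt : slope n₀ n₁ h' < slope n₀ n₁ g' := by
    by_contra! hc
    exact hne (le_antisymm ((E.slope_le_slope hg' hh').1 hc) key')
  exact (hmax h ⟨hh, hθh⟩).trans_lt (hlt.trans_le (hmin g ⟨hg, hθg⟩))

lemma exists_separates_of_slope (E : Extension F T γ n₀ n₁ θ)
    (hs : ∀ h ∈ hat F γ, ∀ g ∈ hat F γ, 0 < θ h → θ g < 0 → slope n₀ n₁ h < slope n₀ n₁ g) :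
    ∃ θ', Separates θ' F T ∧ θ' γ ≤ 0 := by
  have hfin := E.finite_hat
  obtain ⟨τ, hτ₁, hτ₂⟩ : ∃ τ : ℝ, (∀ h ∈ hat F γ, 0 < θ h → slope n₀ n₁ h < τ) ∧
      ∀ g ∈ hat F γ, θ g < 0 → τ < slope n₀ n₁ g := by
    have h1 : {h ∈ hat F γ | 0 < θ h}.Finite := hfin.subset (Set.sep_subset _ _)
    have h2 : {g ∈ hat F γ | θ g < 0}.Finite := hfin.subset (Set.sep_subset _ _)
    obtain ⟨τ, hτ₁, hτ₂⟩ := Order.exists_between_finsets (h1.toFinset.image (slope n₀ n₁))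
      (h2.toFinset.image (slope n₀ n₁)) (by
        simp only [Finset.mem_image, Set.Finite.mem_toFinset]
        rintro _ ⟨h, hh, rfl⟩ _ ⟨g, hg, rfl⟩
        exact hs h hh.1 g hg.1 hh.2 hg.2)
    exact ⟨τ, fun h hh hp => hτ₁ _ (Finset.mem_image_of_mem _ (h1.mem_toFinset.2 ⟨hh, hp⟩)),
      fun g hg hn => hτ₂ _ (Finset.mem_image_of_mem _ (h2.mem_toFinset.2 ⟨hg, hn⟩))⟩
  let θ' : V →ₗ[ℝ] ℝ := τ • (co n₀ + co n₁) - co n₀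
  have hθ' (v : V) : θ' v = τ * (co n₀ v + co n₁ v) - co n₀ v := rfl
  have hp {f : V} (hf : f ∈ hat F γ) (h : 0 < θ f) : 0 < θ' f := by
    have := hτ₁ f hf h
    rw [slope, div_lt_iff₀ (E.co_add_pos hf)] at this
    rw [hθ']
    linarith
  have hn {f : V} (hf : f ∈ hat F γ) (h : θ f < 0) : θ' f < 0 := by
    have := hτ₂ f hf h
    rw [slope, lt_div_iff₀ (E.co_add_pos hf)] at this
    rw [hθ']
    linarith
  refine ⟨θ', ⟨fun v hv => ?_, fun v hv hvT => ?_⟩, ?_⟩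
  · have h := E.sep.1 v hv
    rcases E.mem_hat_or (E.subset hv) with h' | h'
    · exact hp h' h
    · simpa using hn h' (by simpa using h)
  · have h := E.sep.2 v hv hvT
    rcases E.mem_hat_or hv with h' | h'
    · exact hn h' h
    · simpa using hp h' (by simpa using h)
  · simp [hθ', co_apply, B_comm γ, E.frame.B₀γ, E.frame.B₁γ]

lemma exists_separates (E : Extension F T γ n₀ n₁ θ) (h0 : ht n₀ < ht γ) :
    ∃ θ', Separates θ' F T ∧ θ' γ ≤ 0 := by
  have h1 : ((1 : ℕ) : ℝ) • n₀ - γ ∈ hat F γ :=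
    E.translate_mem_hat 1 le_rfl (by push_cast; linarith [E.frame.pos.ht_pos])
  have hne := E.ne_zero h1
  rw [Nat.cast_one, one_smul, map_sub] at hne
  rcases lt_or_gt_of_ne (sub_ne_zero.1 hne) with hν | hν
  · exact E.symm.exists_separates_of_slope fun h hh g hg =>
      E.symm.slope_lt_slope (fun f hf => E.le_of_pos h0 hν hf) hh hg
  · rcases le_or_gt (θ n₁) (θ γ) with hlam | hlam
    · exact E.exists_separates_of_slope fun h hh g hg =>
        E.slope_lt_slope (fun f hf _ => E.mul_co_le h0 hlam hf) hh hg
    · exact E.exists_separates_of_slope fun h hh g hg _ hn =>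
        absurd (E.pos_of_lt h0 hlam hν hg) hn.not_gt

end Extension

/-! ### Separability of the initial sets -/

lemma Separates.neg {F T : Set V} {θ : V →ₗ[ℝ] ℝ} (h : Separates θ F (F \ T)) (hT : T ⊆ F) :
    Separates (-θ) F T := by
  constructor
  · intro v hv
    simpa using h.2 v (hT hv) fun h' => h'.2 hv
  · intro v hv hvT
    simpa using h.1 v ⟨hv, hvT⟩

lemma Separates.exists_insert {F T : Set V} {γ : V} {θ : V →ₗ[ℝ] ℝ} (h : Separates θ F T)
    (hT : T ⊆ F) (hF : F.Finite) (hpos : ∀ f ∈ F, IsPos f) (hγ : IsPos γ) (hθ : θ γ ≤ 0) :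
    ∃ θ', Separates θ' (insert γ F) T := by
  have hev : ∀ᶠ ε : ℝ in nhdsWithin 0 (Set.Ioi 0), ∀ f ∈ T, 0 < θ f - ε * ht f := by
    refine (Filter.eventually_all_finite (hF.subset hT)).2 fun f hf => ?_
    have hc : Filter.Tendsto (fun ε : ℝ => θ f - ε * ht f) (nhdsWithin 0 (Set.Ioi 0))
        (nhds (θ f - 0 * ht f)) :=
      (Continuous.tendsto (by fun_prop) 0).mono_left nhdsWithin_le_nhds
    exact hc.eventually_const_lt (by simpa using h.1 f hf)
  obtain ⟨ε, hε, (hε0 : 0 < ε)⟩ := (hev.and self_mem_nhdsWithin).exists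
  refine ⟨θ - ε • ht, fun f hf => by simpa using hε f hf, ?_⟩
  have hlt {v : V} (hv : IsPos v) (h' : θ v ≤ 0) : (θ - ε • ht) v < 0 := by
    have := mul_pos hε0 hv.ht_pos
    simp only [LinearMap.sub_apply, LinearMap.smul_apply, smul_eq_mul]
    linarith
  rintro v (rfl | hv) hvT
  · exact hlt hγ hθ
  · exact hlt (hpos v hv) (h.2 v hv hvT).le

lemma Separates.exists_of_ht_eq_one {F T : Set V} {γ : V} {θ : V →ₗ[ℝ] ℝ} (h : Separates θ F T)
    (hT : T ⊆ F) (hpos : ∀ f ∈ F, IsPos f) (hle : ∀ f ∈ F, ht f ≤ ht γ) (hγF : γ ∉ F)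
    (hγ : IsPos γ) (h1 : ht γ = 1) : ∃ θ', Separates θ' F T ∧ θ' γ ≤ 0 := by
  have hB (f) (hf : f ∈ F) : ht f + B f γ = 0 := by
    have hp := hpos f hf
    have hht : ht f = 1 := le_antisymm (h1 ▸ hle f hf) hp.one_le_ht
    have hn : B f γ ≤ -1 := (hp.1.B_or hγ.1).resolve_left fun hB =>
      hγF (hp.eq_of_ht_eq hγ hB (hht.trans h1.symm) ▸ hf)
    obtain ⟨k, hk⟩ := hp.1.exists_B hγ.1
    have hg := gram_ineq hp.1.2 hγ.1.2
    rw [hht, h1, hk] at hg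
    rw [hk] at hn
    rw [hht, hk]
    have hk1 : -2 < k := by
      have : (-2 : ℝ) < k := by nlinarith
      exact_mod_cast this
    have hk2 : k < 0 := by
      have : (k : ℝ) < 0 := by linarith
      exact_mod_cast this
    obtain rfl : k = -1 := by omega
    norm_num
  let θ' : V →ₗ[ℝ] ℝ := θ - (θ γ / 2) • (ht + Bl γ)
  have hθ' (f) (hf : f ∈ F) : θ' f = θ f := by
    have := hB f hf
    simp only [θ', LinearMap.sub_apply, LinearMap.smul_apply, LinearMap.add_apply, Bl_apply,
      smul_eq_mul, this]
    ring
  refine ⟨θ', ⟨fun v hv => ?_, fun v hv hvT => ?_⟩, ?_⟩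
  · rw [hθ' v (hT hv)]
    exact h.1 v hv
  · rw [hθ' v hv]
    exact h.2 v hv hvT
  · simp only [θ', LinearMap.sub_apply, LinearMap.smul_apply, LinearMap.add_apply, Bl_apply,
      smul_eq_mul, h1, hγ.1.2]
    linarith

lemma Separable.insert {F : Set V} (hsep : Separable F) {γ : V} (hF : F.Finite)
    (hpos : ∀ f ∈ F, IsPos f) (hlt : ∀ f, IsPos f → ht f < ht γ → f ∈ F)
    (hle : ∀ f ∈ F, ht f ≤ ht γ) (hγF : γ ∉ F) (hγ : IsPos γ) : Separable (insert γ F) := by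
  have main (T : Set V) (hT : T ⊆ F) (hcl : RelClosed (Insert.insert γ F) T)
      (hco : RelClosed (Insert.insert γ F) (Insert.insert γ F \ T)) :
      ∃ θ, Separates θ (Insert.insert γ F) T := by
    obtain ⟨θ, hθ⟩ := hsep T hT
      (fun a ha b hb v hv hc => hcl a ha b hb v (Or.inr hv) hc)
      (fun a ha b hb v hv hc => ⟨hv, (hco a ⟨Or.inr ha.1, ha.2⟩ b ⟨Or.inr hb.1, hb.2⟩ v
        (Or.inr hv) hc).2⟩)
    obtain ⟨θ', hθ', hle'⟩ : ∃ θ', Separates θ' F T ∧ θ' γ ≤ 0 := by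
      rcases le_or_gt (θ γ) 0 with h0 | h0
      · exact ⟨θ, hθ, h0⟩
      by_cases h1 : ht γ = 1
      · exact hθ.exists_of_ht_eq_one hT hpos hle hγF hγ h1
      obtain ⟨n₀, n₁, hfr, hn₀⟩ := hγ.exists_frame_lt h1
      exact Extension.exists_separates (n₁ := n₁) (θ := θ)
        ⟨hfr, hF, hpos, hlt, hle, hγF, hT, hcl, hco, hθ, h0⟩ hn₀
    exact hθ'.exists_insert hT hF hpos hγ hle'
  intro T hT hcl hco
  by_cases hγT : γ ∈ T
  · obtain ⟨θ, hθ⟩ := main (Insert.insert γ F \ T)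
      (fun v hv => hv.1.resolve_left fun h => hv.2 (h ▸ hγT)) hco
      (by rwa [sdiff_sdiff_right_self, inf_eq_right.2 hT])
    exact ⟨-θ, hθ.neg hT⟩
  · exact main T (fun v hv => (hT hv).resolve_left fun h => hγT (h ▸ hv)) hcl hco

lemma separable_initial (n : ℕ) : Separable (initial n) := by
  induction n with
  | zero => exact fun T hT _ _ => ⟨0, fun v hv => absurd (hT hv).2 (by omega),
      fun v hv => absurd hv.2 (by omega)⟩
  | succ n ih =>
    by_cases h : ∃ γ, IsPos γ ∧ key γ = n
    · obtain ⟨γ, hγ, rfl⟩ := h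
      have : initial (key γ + 1) = insert γ (initial (key γ)) := by
        ext f
        simp only [initial, Set.mem_insert_iff, Set.mem_ofPred_eq]
        constructor
        · rintro ⟨hf, hk⟩
          rcases (Nat.lt_succ_iff.1 hk).eq_or_lt with he | hlt
          · exact Or.inl (key_injOn hf hγ he)
          · exact Or.inr ⟨hf, hlt⟩
        · rintro (rfl | ⟨hf, hk⟩)
          · exact ⟨hγ, by omega⟩
          · exact ⟨hf, by omega⟩
      rw [this]
      exact ih.insert (finite_initial _) (fun f hf => hf.1)
        (fun f hf hlt => ⟨hf, key_lt_key hf hγ hlt⟩) (fun f hf => ht_le_ht hf.1 hγ hf.2.le)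
        (fun h => lt_irrefl _ h.2) hγ
    · have : initial (n + 1) = initial n := by
        ext f
        refine ⟨fun hf => ⟨hf.1, ?_⟩, fun hf => ⟨hf.1, hf.2.trans (by omega)⟩⟩
        have h1 := hf.2
        have h2 : key f ≠ n := fun h' => h ⟨f, hf.1, h'⟩
        omega
      rwa [this]

/-- For any collection of biclosed subsets of `Φ⁺`, the smallest closed subset of `Φ⁺`
containing their union is biclosed, and it is the least upper bound of the collection
in the poset of biclosed subsets of `Φ⁺` ordered by inclusion. -/
theorem two_closure_of_union_is_join {I : Type*} (R : I → Set V)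
    (hR : ∀ i, IsBiclosed (R i)) (T : Set V)
    (hT : T = ⋂₀ {C : Set V | C ⊆ Φpos ∧ IsClosedSet C ∧ (⋃ i, R i) ⊆ C}) :
    IsBiclosed T ∧ (∀ i, R i ⊆ T) ∧
      ∀ B : Set V, IsBiclosed B → (∀ i, R i ⊆ B) → T ⊆ B :=
  two_closure_of_union_is_join_of_separable separable_initial R hR T hT
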